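/- arXiv:1709.00869 — 3 statements merged into one kernel-verified Lean document; each statement's English description precedes it below -/
import Mathlib

section
/- There are universal constants c₀, C > 0 such that the following holds. Let G=(V,E) be a finite connected graph with n vertices, m edges and relaxation time t_rel, let x be any vertex, let K ≥ 1, and let 𝓙_t^{(1)},…,𝓙_t^{(K)} be independent copies of the weighted number of intersections 𝓙_t of two independent lazy random walks started at x, counted over the time window [t_unif, t_unif+t−1]. Define the estimator m̃_t = t² / ((2/K)·Σ_{k=1}^K 𝓙_t^{(k)}). Then for every t ≥ c₀·t_rel^{5/6}·√n, P_x(|m̃_t/m − 1| > 1/2) ≤ C/K. -/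
open Finset
open scoped Classical BigOperators

/-- The transition matrix of the lazy random walk on a finite graph `G`. -/
noncomputable def lazyP {V : Type} [Fintype V] (G : SimpleGraph V) : Matrix V V ℝ :=
  fun u v =>
    if u = v then 1 / 2
    else if G.Adj u v then 1 / (2 * (G.degree u : ℝ)) else 0

/-- The number of edges of `G`. -/
noncomputable def numEdges {V : Type} [Fintype V] (G : SimpleGraph V) : ℕ :=
  G.edgeFinset.card

/-- The stationary distribution `π(u) = deg(u) / (2m)` of the lazy random walk. -/
noncomputable def statDist {V : Type} [Fintype V] (G : SimpleGraph V) (u : V) : ℝ :=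
  (G.degree u : ℝ) / (2 * (numEdges G : ℝ))

/-- The second-largest eigenvalue `λ₂` of a reversible transition matrix: the supremum of
the (real) eigenvalues different from `1`. -/
noncomputable def secondEig {V : Type} [Fintype V] (P : Matrix V V ℝ) : ℝ :=
  sSup {r : ℝ | r ≠ 1 ∧ ∃ f : V → ℝ, f ≠ 0 ∧ P.mulVec f = r • f}

/-- The relaxation time `t_rel = ⌈1 / (1 - λ₂)⌉`. -/
noncomputable def relTime {V : Type} [Fintype V] (P : Matrix V V ℝ) : ℕ :=
  ⌈1 / (1 - secondEig P)⌉₊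

/-- The uniform mixing time of the lazy random walk on `G`. -/
noncomputable def unifTime {V : Type} [Fintype V] (G : SimpleGraph V) : ℕ :=
  sInf {t : ℕ | ∀ x y : V, |(lazyP G ^ t) x y / statDist G y - 1| ≤ 1 / 4}

/-- The Green's function `g_t(x, u) = ∑_{i<t} P^i(x, u)`. -/
noncomputable def green {V : Type} [Fintype V] (P : Matrix V V ℝ) (t : ℕ) (x u : V) : ℝ :=
  ∑ i ∈ Finset.range t, (P ^ i) x u

/-- The value of a finite trajectory at a natural number index (junk beyond the horizon). -/
noncomputable def traj {V : Type} [Nonempty V] {t : ℕ} (p : Fin t → V) (i : ℕ) : V :=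
  if h : i < t then p ⟨i, h⟩ else Classical.arbitrary V

/-- The probability that the chain `P` started at `x` follows the length-`t` trajectory `p`. -/
noncomputable def pathWeight {V : Type} [Fintype V] [Nonempty V] (P : Matrix V V ℝ)
    (x : V) (t : ℕ) (p : Fin t → V) : ℝ :=
  (if traj p 0 = x then 1 else 0) *
    ∏ i ∈ Finset.range (t - 1), P (traj p i) (traj p (i + 1))

/-- Expectation of a functional of two independent length-`t` walks started at `x` and `y`. -/
noncomputable def E2 {V : Type} [Fintype V] [Nonempty V] (P : Matrix V V ℝ) (x y : V)
    (t : ℕ) (F : (Fin t → V) → (Fin t → V) → ℝ) : ℝ :=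
  ∑ p : Fin t → V, ∑ q : Fin t → V, pathWeight P x t p * pathWeight P y t q * F p q

/-- Expectation of a functional of three independent length-`t` walks started at `x`. -/
noncomputable def E3 {V : Type} [Fintype V] [Nonempty V] (P : Matrix V V ℝ) (x : V)
    (t : ℕ) (F : (Fin t → V) → (Fin t → V) → (Fin t → V) → ℝ) : ℝ :=
  ∑ p : Fin t → V, ∑ q : Fin t → V, ∑ r : Fin t → V,
    pathWeight P x t p * pathWeight P x t q * pathWeight P x t r * F p q r

/-- Expectation of a functional of `2K` independent length-`t` walks
(`K` pairs) started at `x`. -/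
noncomputable def EK {V : Type} [Fintype V] [Nonempty V] (P : Matrix V V ℝ) (x : V)
    (t K : ℕ) (F : (Fin K → Fin t → V) → (Fin K → Fin t → V) → ℝ) : ℝ :=
  ∑ X : Fin K → Fin t → V, ∑ Y : Fin K → Fin t → V,
    (∏ k, pathWeight P x t (X k)) * (∏ k, pathWeight P x t (Y k)) * F X Y

/-- Expectation of a functional of `K` independent length-`t` walks started at `x`. -/
noncomputable def EKone {V : Type} [Fintype V] [Nonempty V] (P : Matrix V V ℝ) (x : V)
    (t K : ℕ) (F : (Fin K → Fin t → V) → ℝ) : ℝ :=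
  ∑ X : Fin K → Fin t → V, (∏ k, pathWeight P x t (X k)) * F X

/-- The weighted number of intersections of two trajectories over the time window `[a, b)`:
`∑_{i,j=a}^{b-1} (1 / deg(p_i)) 1{p_i = q_j}`. -/
noncomputable def wInterIco {V : Type} [Fintype V] [Nonempty V] (G : SimpleGraph V)
    (a b : ℕ) {t : ℕ} (p q : Fin t → V) : ℝ :=
  ∑ i ∈ Finset.Ico a b, ∑ j ∈ Finset.Ico a b,
    if traj p i = traj q j then 1 / (G.degree (traj p i) : ℝ) else 0

/-- The weighted number of intersections `𝓘_t` of two trajectories, up to time `t - 1`. -/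
noncomputable def wInter {V : Type} [Fintype V] [Nonempty V] (G : SimpleGraph V)
    {t : ℕ} (p q : Fin t → V) : ℝ :=
  wInterIco G 0 t p q

/-- The (unweighted) number of intersections `I_t` of two trajectories, up to time `t - 1`. -/
noncomputable def nInter {V : Type} [Nonempty V] {t : ℕ} (p q : Fin t → V) : ℝ :=
  ∑ i ∈ Finset.range t, ∑ j ∈ Finset.range t,
    if traj p i = traj q j then (1 : ℝ) else 0

/-- `E_{x,y}[𝓘_t]`: expected weighted number of intersections of two independent lazy random
walks started at `x` and `y`. -/
noncomputable def EIxy {V : Type} [Fintype V] [Nonempty V] (G : SimpleGraph V)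
    (x y : V) (t : ℕ) : ℝ :=
  E2 (lazyP G) x y t fun p q => wInter G p q

/-- `E_x[𝓘_t]`. -/
noncomputable def EI {V : Type} [Fintype V] [Nonempty V] (G : SimpleGraph V)
    (x : V) (t : ℕ) : ℝ :=
  EIxy G x x t

/-- `E_x[𝓘_t²]`. -/
noncomputable def EIsq {V : Type} [Fintype V] [Nonempty V] (G : SimpleGraph V)
    (x : V) (t : ℕ) : ℝ :=
  E2 (lazyP G) x x t fun p q => (wInter G p q) ^ 2

/-- `E_x[𝓙_t]`: expected weighted number of intersections over the window
`[t_unif, t_unif + t - 1]`. -/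
noncomputable def EJ {V : Type} [Fintype V] [Nonempty V] (G : SimpleGraph V)
    (x : V) (t : ℕ) : ℝ :=
  E2 (lazyP G) x x (unifTime G + t) fun p q =>
    wInterIco G (unifTime G) (unifTime G + t) p q

/-- `E_x[𝓙_t²]`. -/
noncomputable def EJsq {V : Type} [Fintype V] [Nonempty V] (G : SimpleGraph V)
    (x : V) (t : ℕ) : ℝ :=
  E2 (lazyP G) x x (unifTime G + t) fun p q =>
    (wInterIco G (unifTime G) (unifTime G + t) p q) ^ 2

/-- `E_x[ℒ_t]`: expected weighted number of intersections between times `t` and `2t - 1`. -/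
noncomputable def EL {V : Type} [Fintype V] [Nonempty V] (G : SimpleGraph V)
    (x : V) (t : ℕ) : ℝ :=
  E2 (lazyP G) x x (2 * t) fun p q => wInterIco G t (2 * t) p q

/-- `E_x[ℒ_t²]`. -/
noncomputable def ELsq {V : Type} [Fintype V] [Nonempty V] (G : SimpleGraph V)
    (x : V) (t : ℕ) : ℝ :=
  E2 (lazyP G) x x (2 * t) fun p q => (wInterIco G t (2 * t) p q) ^ 2

/-- `E_x[ℒ_t^{(X,Y)} · ℒ_t^{(X,Z)}]` for three independent walks `X, Y, Z` started at `x`. -/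
noncomputable def ELprod {V : Type} [Fintype V] [Nonempty V] (G : SimpleGraph V)
    (x : V) (t : ℕ) : ℝ :=
  E3 (lazyP G) x (2 * t) fun p q r =>
    wInterIco G t (2 * t) p q * wInterIco G t (2 * t) p r

/-- The inner product `⟨f, g⟩_π = ∑_x π(x) f(x) g(x)`. -/
noncomputable def ipi {X : Type} [Fintype X] (π : X → ℝ) (f g : X → ℝ) : ℝ :=
  ∑ x, π x * f x * g x

/-- The position of the first occurrence of `s i` in the finite sequence `s`. -/
noncomputable def firstOcc {V : Type} {N : ℕ} (s : Fin N → V) (i : Fin N) : ℕ :=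
  sInf {j : ℕ | ∃ h : j < N, s ⟨j, h⟩ = s i}

/-- The index (rank) of first occurrence of `s i` among the distinct values of `s`,
in order of first appearance. -/
noncomputable def rankSeq {V : Type} {N : ℕ} (s : Fin N → V) (i : Fin N) : ℕ :=
  ((Finset.univ.image fun j : Fin N => firstOcc s j).filter
    fun a => a ≤ firstOcc s i).card

/-- The profile `Φ` of a finite sequence of vertices: the sequence of ranks of first
occurrence together with the sequence of degrees. -/
noncomputable def profileOf {V : Type} [Fintype V] (G : SimpleGraph V) {N : ℕ}
    (s : Fin N → V) : Fin N → ℕ × ℕ :=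
  fun i => (rankSeq s i, G.degree (s i))

/-- Concatenation of `K` trajectories of length `t` into one sequence of length `K * t`. -/
noncomputable def concatW {V : Type} [Nonempty V] {K t : ℕ} (X : Fin K → Fin t → V)
    (i : Fin (K * t)) : V :=
  if h : 0 < t then
    X ⟨i.1 / t, (Nat.div_lt_iff_lt_mul h).2 i.2⟩ ⟨i.1 % t, Nat.mod_lt _ h⟩
  else Classical.arbitrary V

lemma aux_prod_one {Ω : Type} [Fintype Ω] (w : Ω → ℝ) (hw : ∑ o, w o = 1) (K : ℕ) :
    ∑ ω : Fin K → Ω, (∏ k, w (ω k)) = 1 := by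
  have := Finset.prod_univ_sum (fun _ : Fin K => (Finset.univ : Finset Ω)) (fun _ o => w o)
  simp only [Fintype.piFinset_univ] at this
  rw [← this]; simp [hw]

lemma aux_cons {Ω : Type} [Fintype Ω] (K : ℕ) (F : (Fin (K+1) → Ω) → ℝ) :
    ∑ ω : Fin (K+1) → Ω, F ω = ∑ o : Ω, ∑ ω : Fin K → Ω, F (Fin.cons o ω) := by
  rw [← (Fin.consEquiv (fun _ : Fin (K+1) => Ω)).sum_comp, Fintype.sum_prod_type]
  rfl

lemma aux_prod_mean {Ω : Type} [Fintype Ω] (w g : Ω → ℝ) (hw : ∑ o, w o = 1)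
    (hg : ∑ o, w o * g o = 0) (K : ℕ) :
    ∑ ω : Fin K → Ω, (∏ k, w (ω k)) * (∑ k, g (ω k)) = 0 := by
  induction K with
  | zero => simp
  | succ K ih =>
    rw [aux_cons]
    simp only [Fin.prod_univ_succ, Fin.sum_univ_succ, Fin.cons_zero, Fin.cons_succ]
    have : ∀ o : Ω, ∑ ω : Fin K → Ω, (w o * ∏ k, w (ω k)) * (g o + ∑ k, g (ω k)) = w o * g o := by
      intro o
      have e : ∀ ω : Fin K → Ω, (w o * ∏ k, w (ω k)) * (g o + ∑ k, g (ω k)) =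
        (w o * g o) * (∏ k, w (ω k)) + w o * ((∏ k, w (ω k)) * ∑ k, g (ω k)) := by
        intro ω; ring
      simp only [e, Finset.sum_add_distrib, ← Finset.mul_sum, ih, aux_prod_one w hw K]
      ring
    simp only [this, hg]

lemma aux_prod_var {Ω : Type} [Fintype Ω] (w g : Ω → ℝ) (hw : ∑ o, w o = 1)
    (hg : ∑ o, w o * g o = 0) (K : ℕ) :
    ∑ ω : Fin K → Ω, (∏ k, w (ω k)) * (∑ k, g (ω k)) ^ 2 = K * ∑ o, w o * g o ^ 2 := by
  induction K with
  | zero => simp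
  | succ K ih =>
    rw [aux_cons]
    simp only [Fin.prod_univ_succ, Fin.sum_univ_succ, Fin.cons_zero, Fin.cons_succ]
    have : ∀ o : Ω, ∑ ω : Fin K → Ω, (w o * ∏ k, w (ω k)) * (g o + ∑ k, g (ω k)) ^ 2
        = w o * g o ^ 2 + w o * (K * ∑ o, w o * g o ^ 2) := by
      intro o
      have e : ∀ ω : Fin K → Ω, (w o * ∏ k, w (ω k)) * (g o + ∑ k, g (ω k)) ^ 2 =
        (w o * g o ^ 2) * (∏ k, w (ω k)) + (2 * w o * g o) * ((∏ k, w (ω k)) * ∑ k, g (ω k))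
         + w o * ((∏ k, w (ω k)) * (∑ k, g (ω k)) ^ 2) := by
        intro ω; ring
      simp only [e, Finset.sum_add_distrib, ← Finset.mul_sum, ih, aux_prod_one w hw K,
        aux_prod_mean w g hw hg K]
      ring
    simp only [this, Finset.sum_add_distrib, ← Finset.sum_mul, hw]
    push_cast; ring

lemma aux_traj_cons_zero {V : Type} [Nonempty V] {T : ℕ} (a : V) (p : Fin T → V) :
    traj (Fin.cons a p : Fin (T+1) → V) 0 = a := by
  simp [traj]

lemma aux_traj_cons_succ {V : Type} [Nonempty V] {T : ℕ} (a : V) (p : Fin T → V) (i : ℕ) :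
    traj (Fin.cons a p : Fin (T+1) → V) (i+1) = traj p i := by
  unfold traj
  by_cases h : i < T
  · rw [dif_pos h, dif_pos (by omega)]
    exact Fin.cons_succ (α := fun _ => V) a p ⟨i, h⟩
  · rw [dif_neg h, dif_neg (by omega)]

lemma aux_step {V : Type} [Fintype V] [Nonempty V] (P : Matrix V V ℝ) (x : V) (T : ℕ)
    (F : (Fin (T+2) → V) → ℝ) :
    ∑ p, pathWeight P x (T+2) p * F p =
      ∑ y, P x y * ∑ p : Fin (T+1) → V, pathWeight P y (T+1) p * F (Fin.cons x p) := by
  rw [aux_cons]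
  have h1 : ∀ (a : V) (p : Fin (T+1) → V), pathWeight P x (T+2) (Fin.cons a p) =
      if a = x then ∑ y, P x y * pathWeight P y (T+1) p else 0 := by
    intro a p
    unfold pathWeight
    rw [aux_traj_cons_zero]
    by_cases h : a = x
    · subst h
      have e : T + 2 - 1 = (T + 1 - 1) + 1 := by omega
      rw [e, Finset.prod_range_succ']
      simp only [aux_traj_cons_succ, aux_traj_cons_zero]
      rw [Finset.sum_eq_single (traj p 0)]
      · simp; ring
      · intro b _ hb
        simp [Ne.symm hb]
      · simp
    · simp [h]
  simp only [h1]
  rw [Finset.sum_eq_single x]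
  · simp only [if_true, Finset.sum_mul, Finset.mul_sum]
    rw [Finset.sum_comm]
    refine Finset.sum_congr rfl fun y _ => Finset.sum_congr rfl fun p _ => by ring
  · intro b _ hb; simp [hb]
  · simp

lemma aux_base {V : Type} [Fintype V] [Nonempty V] (P : Matrix V V ℝ) (x : V)
    (F : (Fin 1 → V) → ℝ) :
    ∑ p, pathWeight P x 1 p * F p = F (fun _ => x) := by
  rw [Finset.sum_eq_single (fun _ => x)]
  · simp [pathWeight, traj]
  · intro p _ hp
    have : traj p 0 ≠ x := by
      intro h
      apply hp
      funext i
      rw [← h]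
      simp [traj, Subsingleton.elim i 0]
    simp [pathWeight, this]
  · simp

lemma aux_mass {V : Type} [Fintype V] [Nonempty V] (P : Matrix V V ℝ) (hP : ∀ u, ∑ v, P u v = 1)
    (T : ℕ) : ∀ (x : V), ∑ p, pathWeight P x (T+1) p = 1 := by
  induction T with
  | zero => intro x; simpa using aux_base P x (fun _ => 1)
  | succ T ih =>
    intro x
    have := aux_step P x T (fun _ => 1)
    simp only [mul_one, ih, hP] at this
    exact this

lemma aux_nonneg {V : Type} [Fintype V] [Nonempty V] (P : Matrix V V ℝ) (hP : ∀ u v, 0 ≤ P u v)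
    (T : ℕ) (x : V) (p : Fin T → V) : 0 ≤ pathWeight P x T p := by
  unfold pathWeight
  refine mul_nonneg (by split_ifs <;> norm_num) (Finset.prod_nonneg fun i _ => hP _ _)

lemma aux_one {V : Type} [Fintype V] [Nonempty V] (P : Matrix V V ℝ) (hP : ∀ u, ∑ v, P u v = 1)
    (f : V → ℝ) (T : ℕ) : ∀ (i : ℕ) (x : V), i ≤ T →
      ∑ p, pathWeight P x (T+1) p * f (traj p i) = ∑ u, (P ^ i) x u * f u := by
  induction T with
  | zero =>
    intro i x hi
    obtain rfl : i = 0 := by omega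
    rw [aux_base]
    simp [traj, Matrix.one_apply]
  | succ T ih =>
    intro i x hi
    rw [aux_step]
    rcases i with _ | i
    · simp only [aux_traj_cons_zero, ← Finset.sum_mul, aux_mass P hP, mul_one, hP]
      simp [Matrix.one_apply]
    · simp only [aux_traj_cons_succ]
      simp only [ih i _ (by omega), pow_succ', Matrix.mul_apply, Finset.sum_mul, Finset.mul_sum]
      rw [Finset.sum_comm]
      refine Finset.sum_congr rfl fun y _ => Finset.sum_congr rfl fun p _ => by ring

lemma aux_two {V : Type} [Fintype V] [Nonempty V] (P : Matrix V V ℝ) (hP : ∀ u, ∑ v, P u v = 1)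
    (f g : V → ℝ) (T : ℕ) : ∀ (i j : ℕ) (x : V), i + j ≤ T →
      ∑ p, pathWeight P x (T+1) p * (f (traj p i) * g (traj p (i+j)))
        = ∑ u, (P ^ i) x u * (f u * ∑ v, (P ^ j) u v * g v) := by
  induction T with
  | zero =>
    intro i j x hi
    obtain rfl : i = 0 := by omega
    obtain rfl : j = 0 := by omega
    rw [aux_base]
    simp [traj, Matrix.one_apply]
  | succ T ih =>
    intro i j x hi
    rcases i with _ | i
    · have h := aux_one P hP g (T+1) j x (by omega)
      rw [aux_step] at h ⊢
      simp only [aux_traj_cons_zero, zero_add]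
      have e : ∀ y, ∑ p : Fin (T+1) → V, pathWeight P y (T+1) p *
          (f x * g (traj (Fin.cons x p : Fin (T+2) → V) j)) =
          f x * ∑ p : Fin (T+1) → V, pathWeight P y (T+1) p *
            g (traj (Fin.cons x p : Fin (T+2) → V) j) := by
        intro y; rw [Finset.mul_sum]; exact Finset.sum_congr rfl fun p _ => by ring
      simp only [e]
      simp only [mul_left_comm _ (f x), ← Finset.mul_sum, h]
      simp [Matrix.one_apply]
    · rw [aux_step]
      have e : i + 1 + j = (i + j) + 1 := by omega
      simp only [e, aux_traj_cons_succ]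
      simp only [ih i j _ (by omega), pow_succ' P i, Matrix.mul_apply]
      simp only [Finset.sum_mul, Finset.mul_sum (Finset.univ : Finset V) _ (P x _)]
      rw [Finset.sum_comm]
      refine Finset.sum_congr rfl fun y _ => Finset.sum_congr rfl fun p _ => by ring

lemma aux_deg_pos {V : Type} [Fintype V] [Nontrivial V] (G : SimpleGraph V) (hG : G.Connected)
    (u : V) : (0 : ℝ) < G.degree u := by
  exact_mod_cast hG.preconnected.degree_pos_of_nontrivial u

lemma aux_deg_sum {V : Type} [Fintype V] (G : SimpleGraph V) (u : V) :
    ∑ v, (if G.Adj u v then (1 : ℝ) else 0) = G.degree u := by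
  rw [Finset.sum_boole, ← SimpleGraph.card_neighborFinset_eq_degree]
  congr 2
  ext v; simp

lemma aux_deg_total {V : Type} [Fintype V] (G : SimpleGraph V) :
    ∑ u, (G.degree u : ℝ) = 2 * (numEdges G : ℝ) := by
  have := G.sum_degrees_eq_twice_card_edges
  unfold numEdges
  exact_mod_cast this

lemma aux_P_eq {V : Type} [Fintype V] (G : SimpleGraph V) (u v : V) :
    lazyP G u v = (if u = v then 1 / 2 else 0) +
      (if G.Adj u v then 1 else 0) * (1 / (2 * (G.degree u : ℝ))) := by
  unfold lazyP
  by_cases h : u = v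
  · subst h; simp
  · simp [h]

lemma aux_P_nonneg {V : Type} [Fintype V] (G : SimpleGraph V) (u v : V) :
    0 ≤ lazyP G u v := by
  unfold lazyP; split_ifs <;> positivity

lemma aux_P_apply {V : Type} [Fintype V] (G : SimpleGraph V) (h : V → ℝ) (u : V) :
    ∑ v, lazyP G u v * h v = h u / 2 +
      (∑ v, (if G.Adj u v then h v else 0)) / (2 * (G.degree u : ℝ)) := by
  simp only [aux_P_eq, add_mul, Finset.sum_add_distrib, Finset.sum_div]
  congr 1
  · simp [ite_mul]; ring
  · refine Finset.sum_congr rfl fun v _ => ?_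
    split_ifs <;> simp; ring

lemma aux_P_row {V : Type} [Fintype V] [Nontrivial V] (G : SimpleGraph V) (hG : G.Connected)
    (u : V) : ∑ v, lazyP G u v = 1 := by
  have h := aux_P_apply G (fun _ => 1) u
  have hd := aux_deg_pos G hG u
  simp only [mul_one, aux_deg_sum] at h
  rw [h]; field_simp; norm_num

lemma aux_P_rev {V : Type} [Fintype V] [Nontrivial V] (G : SimpleGraph V) (hG : G.Connected)
    (u v : V) : (G.degree u : ℝ) * lazyP G u v = G.degree v * lazyP G v u := by
  have hu := aux_deg_pos G hG u
  have hv := aux_deg_pos G hG v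
  by_cases h : u = v
  · subst h; rfl
  · have h' : ¬ v = u := fun e => h e.symm
    simp only [lazyP, h, h', if_false, G.adj_comm v u]
    split_ifs
    · field_simp
    · simp

lemma aux_quad {V : Type} [Fintype V] [Nontrivial V] (G : SimpleGraph V) (hG : G.Connected)
    (h : V → ℝ) : 
    (∑ u, (G.degree u : ℝ) * h u * h u = ∑ u, ∑ v, if G.Adj u v then h u ^ 2 else 0) ∧
    (∑ u, (G.degree u : ℝ) * h u * h u = ∑ u, ∑ v, if G.Adj u v then h v ^ 2 else 0) ∧
    (∑ u, (G.degree u : ℝ) * h u * (∑ v, lazyP G u v * h v) =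
      (∑ u, (G.degree u : ℝ) * h u * h u) / 2 + 
      (∑ u, ∑ v, if G.Adj u v then h u * h v else 0) / 2) := by
  have h1 : ∑ u, (G.degree u : ℝ) * h u * h u = ∑ u, ∑ v, if G.Adj u v then h u ^ 2 else 0 := by
    refine Finset.sum_congr rfl fun u _ => ?_
    rw [← aux_deg_sum, Finset.sum_mul, Finset.sum_mul]
    refine Finset.sum_congr rfl fun v _ => ?_
    split_ifs <;> ring
  refine ⟨h1, ?_, ?_⟩
  · rw [h1, Finset.sum_comm]
    simp only [G.adj_comm]
  · rw [Finset.sum_div, Finset.sum_div, ← Finset.sum_add_distrib]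
    refine Finset.sum_congr rfl fun u _ => ?_
    have hu := aux_deg_pos G hG u
    rw [aux_P_apply]
    have : ∑ v, (if G.Adj u v then h u * h v else 0) = h u * ∑ v, if G.Adj u v then h v else 0 := by
      rw [Finset.mul_sum]; refine Finset.sum_congr rfl fun v _ => ?_
      split_ifs <;> ring
    rw [this]
    field_simp

lemma aux_energy {V : Type} [Fintype V] [Nontrivial V] (G : SimpleGraph V) (hG : G.Connected)
    (h : V → ℝ) : 
    (∑ u, ∑ v, if G.Adj u v then (h u - h v) ^ 2 else 0) =
    4 * ∑ u, (G.degree u : ℝ) * h u * (h u - ∑ v, lazyP G u v * h v) := by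
  obtain ⟨h1, h2, h3⟩ := aux_quad G hG h
  simp only [mul_sub, Finset.sum_sub_distrib]
  rw [h3]
  have e : ∀ u v, (if G.Adj u v then (h u - h v) ^ 2 else 0) = (if G.Adj u v then h u ^ 2 else 0) +
    (if G.Adj u v then h v ^ 2 else 0) - 2 * (if G.Adj u v then h u * h v else 0) := by
    intro u v; split_ifs <;> ring
  simp only [e, Finset.sum_sub_distrib, Finset.sum_add_distrib, ← Finset.mul_sum, ← h1, ← h2]
  ring

lemma aux_energy' {V : Type} [Fintype V] [Nontrivial V] (G : SimpleGraph V) (hG : G.Connected)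
    (h : V → ℝ) : 
    (∑ u, ∑ v, if G.Adj u v then (h u + h v) ^ 2 else 0) =
    4 * ∑ u, (G.degree u : ℝ) * h u * (∑ v, lazyP G u v * h v) := by
  obtain ⟨h1, h2, h3⟩ := aux_quad G hG h
  rw [h3]
  have e : ∀ u v, (if G.Adj u v then (h u + h v) ^ 2 else 0) = (if G.Adj u v then h u ^ 2 else 0) +
    (if G.Adj u v then h v ^ 2 else 0) + 2 * (if G.Adj u v then h u * h v else 0) := by
    intro u v; split_ifs <;> ring
  simp only [e, Finset.sum_add_distrib, ← Finset.mul_sum, ← h1, ← h2]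
  ring

lemma aux_const {V : Type} [Fintype V] (G : SimpleGraph V) (hG : G.Connected)
    (h : V → ℝ) (h0 : (∑ u, ∑ v, if G.Adj u v then (h u - h v) ^ 2 else 0) = 0) (u v : V) :
    h u = h v := by
  have hadj : ∀ u v, G.Adj u v → h u = h v := by
    intro u v huv
    rw [Finset.sum_eq_zero_iff_of_nonneg (fun u _ => Finset.sum_nonneg fun v _ => by
      split_ifs <;> positivity)] at h0
    have := h0 u (Finset.mem_univ _)
    rw [Finset.sum_eq_zero_iff_of_nonneg (fun v _ => by split_ifs <;> positivity)] at this
    have := this v (Finset.mem_univ _)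
    simp only [huv, if_true] at this
    have := pow_eq_zero_iff (two_ne_zero) |>.1 this
    linarith
  obtain ⟨p⟩ := hG.preconnected u v
  induction p with
  | nil => rfl
  | cons hh _ ih => exact (hadj _ _ hh).trans ih

/-- spectral decomposition -/
lemma aux_spectral {V : Type} [Fintype V] [Nontrivial V] (G : SimpleGraph V) (hG : G.Connected) :
    ∃ (lam : V → ℝ) (f : V → V → ℝ),
      (∀ k l, ∑ u, (G.degree u : ℝ) * f k u * f l u = if k = l then 1 else 0) ∧
      (∀ u v, ∑ k, f k u * f k v * G.degree v = if u = v then 1 else 0) ∧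
      (∀ k u, ∑ v, lazyP G u v * f k v = lam k * f k u) := by
  have hd := aux_deg_pos G hG
  set s : V → ℝ := fun u => Real.sqrt (G.degree u) with hs
  have hspos : ∀ u, 0 < s u := fun u => Real.sqrt_pos.2 (hd u)
  have hss : ∀ u, s u * s u = G.degree u := fun u => Real.mul_self_sqrt (hd u).le
  let S : Matrix V V ℝ := fun u v => s u * lazyP G u v / s v
  have hS : S.IsHermitian := by
    ext u v
    show s v * lazyP G v u / s u = s u * lazyP G u v / s v
    have := aux_P_rev G hG u v
    rw [← hss, ← hss] at this
    have hu := hspos u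
    have hv := hspos v
    field_simp
    nlinarith
  let psi : V → V → ℝ := fun k u => hS.eigenvectorBasis k u
  have horth : ∀ k l, ∑ u, psi k u * psi l u = if k = l then 1 else 0 := by
    intro k l
    have := orthonormal_iff_ite.1 hS.eigenvectorBasis.orthonormal k l
    rw [← this]
    simp [PiLp.inner_apply, psi, mul_comm]
  let M : Matrix V V ℝ := psi
  have hM : M * M.transpose = 1 := by
    ext k l
    rw [Matrix.mul_apply, Matrix.one_apply]
    exact horth k l
  have hM' := mul_eq_one_comm.1 hM
  refine ⟨hS.eigenvalues, fun k u => psi k u / s u, ?_, ?_, ?_⟩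
  · intro k l
    rw [← horth k l]
    refine Finset.sum_congr rfl fun u _ => ?_
    have hu := hspos u
    rw [← hss]; field_simp
  · intro u v
    have h1 : ∑ k, psi k u * psi k v = if u = v then 1 else 0 := by
      have := congrFun (congrFun hM' u) v
      rw [Matrix.mul_apply, Matrix.one_apply] at this
      exact this
    have hu := hspos u
    have hv := hspos v
    calc ∑ k, psi k u / s u * (psi k v / s v) * G.degree v 
        = (∑ k, psi k u * psi k v) * (s v / s u) := by
          rw [Finset.sum_mul]
          refine Finset.sum_congr rfl fun k _ => ?_
          rw [← hss]; field_simp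
      _ = _ := by
        rw [h1]
        split_ifs with h
        · subst h; field_simp
        · simp
  · intro k u
    have h1 := congrFun (hS.mulVec_eigenvectorBasis k) u
    have hu := hspos u
    simp only [Matrix.mulVec, dotProduct, Pi.smul_apply, smul_eq_mul, S] at h1
    calc ∑ v, lazyP G u v * (psi k v / s v) 
        = (∑ v, s u * lazyP G u v / s v * psi k v) / s u := by
          rw [Finset.sum_div]
          refine Finset.sum_congr rfl fun v _ => ?_
          have hv := hspos v
          field_simp
      _ = _ := by
        rw [h1]; simp only [psi]; ring
lemma aux_parseval {V : Type} [Fintype V] (d : V → ℝ) (f : V → V → ℝ)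
    (ho : ∀ k l, ∑ u, d u * f k u * f l u = if k = l then 1 else 0) (c e : V → ℝ) :
    ∑ u, d u * (∑ k, c k * f k u) * (∑ l, e l * f l u) = ∑ k, c k * e k := by
  have h1 : ∀ u, d u * (∑ k, c k * f k u) * (∑ l, e l * f l u) =
      ∑ k, ∑ l, c k * e l * (d u * f k u * f l u) := by
    intro u
    rw [mul_assoc, Finset.sum_mul_sum, Finset.mul_sum]
    refine Finset.sum_congr rfl fun k _ => ?_
    rw [Finset.mul_sum]
    refine Finset.sum_congr rfl fun l _ => by ring
  simp only [h1]
  rw [Finset.sum_comm]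
  refine Finset.sum_congr rfl fun k _ => ?_
  rw [Finset.sum_comm]
  simp only [← Finset.mul_sum, ho]
  simp

lemma aux_pow {V : Type} [Fintype V] (P : Matrix V V ℝ) (d : V → ℝ) (lam : V → ℝ) (f : V → V → ℝ)
    (hc : ∀ u v, ∑ k, f k u * f k v * d v = if u = v then 1 else 0)
    (he : ∀ k u, ∑ v, P u v * f k v = lam k * f k u) (i : ℕ) : ∀ u v, 
    (P ^ i) u v = ∑ k, lam k ^ i * (f k u * f k v * d v) := by
  induction i with
  | zero => intro u v; simp [hc, Matrix.one_apply]
  | succ i ih =>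
    intro u v
    rw [pow_succ', Matrix.mul_apply]
    simp only [ih, Finset.mul_sum]
    rw [Finset.sum_comm]
    refine Finset.sum_congr rfl fun k _ => ?_
    have : ∀ w, P u w * (lam k ^ i * (f k w * f k v * d v)) = 
      (P u w * f k w) * (lam k ^ i * f k v * d v) := fun w => by ring
    simp only [this, ← Finset.sum_mul, he]
    ring

lemma aux_energy_sum {V : Type} [Fintype V] [Nontrivial V] (G : SimpleGraph V) (hG : G.Connected)
    (lam : V → ℝ) (f : V → V → ℝ)
    (ho : ∀ k l, ∑ u, (G.degree u : ℝ) * f k u * f l u = if k = l then 1 else 0)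
    (he : ∀ k u, ∑ v, lazyP G u v * f k v = lam k * f k u) (c : V → ℝ) :
    (∑ u, ∑ v, if G.Adj u v then ((∑ k, c k * f k u) - (∑ k, c k * f k v)) ^ 2 else 0) =
      4 * ∑ k, c k ^ 2 * (1 - lam k) := by
  rw [aux_energy G hG (fun u => ∑ k, c k * f k u)]
  have h1 : ∀ u, (∑ k, c k * f k u) - ∑ v, lazyP G u v * (∑ k, c k * f k v) =
      ∑ k, (c k * (1 - lam k)) * f k u := by
    intro u
    have : ∑ v, lazyP G u v * (∑ k, c k * f k v) = ∑ k, c k * (lam k * f k u) := by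
      simp only [← he, Finset.mul_sum]
      rw [Finset.sum_comm]
      refine Finset.sum_congr rfl fun k _ => Finset.sum_congr rfl fun v _ => by ring
    rw [this, ← Finset.sum_sub_distrib]
    refine Finset.sum_congr rfl fun k _ => by ring
  simp only [h1]
  rw [aux_parseval _ f ho]
  congr 1
  refine Finset.sum_congr rfl fun k _ => by ring

lemma aux_eig_bounds {V : Type} [Fintype V] [Nontrivial V] (G : SimpleGraph V) (hG : G.Connected)
    (r : ℝ) (h : V → ℝ) (h0 : h ≠ 0) (he : ∀ u, ∑ v, lazyP G u v * h v = r * h u) :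
    0 ≤ r ∧ r ≤ 1 := by
  have hd := aux_deg_pos G hG
  have hpos : 0 < ∑ u, (G.degree u : ℝ) * h u * h u := by
    obtain ⟨u, hu⟩ := Function.ne_iff.1 h0
    have hu : h u ≠ 0 := hu
    refine Finset.sum_pos' (fun v _ => ?_) ⟨u, Finset.mem_univ _, ?_⟩
    · rw [mul_assoc]; exact mul_nonneg (hd v).le (mul_self_nonneg _)
    · rw [mul_assoc]; exact mul_pos (hd u) (mul_self_pos.2 hu)
  have e1 := aux_energy G hG h
  have e2 := aux_energy' G hG h
  have n1 : 0 ≤ (∑ u, ∑ v, if G.Adj u v then (h u - h v) ^ 2 else 0) :=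
    Finset.sum_nonneg fun u _ => Finset.sum_nonneg fun v _ => by split_ifs <;> positivity
  have n2 : 0 ≤ (∑ u, ∑ v, if G.Adj u v then (h u + h v) ^ 2 else 0) :=
    Finset.sum_nonneg fun u _ => Finset.sum_nonneg fun v _ => by split_ifs <;> positivity
  have s1 : ∑ u, (G.degree u : ℝ) * h u * (h u - ∑ v, lazyP G u v * h v) = 
      (1 - r) * ∑ u, (G.degree u : ℝ) * h u * h u := by
    rw [Finset.mul_sum]
    refine Finset.sum_congr rfl fun u _ => ?_
    rw [he]; ring
  have s2 : ∑ u, (G.degree u : ℝ) * h u * (∑ v, lazyP G u v * h v) = 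
      r * ∑ u, (G.degree u : ℝ) * h u * h u := by
    rw [Finset.mul_sum]
    refine Finset.sum_congr rfl fun u _ => ?_
    rw [he]; ring
  rw [s1] at e1
  rw [s2] at e2
  constructor
  · by_contra hh
    push Not at hh
    nlinarith
  · by_contra hh
    push Not at hh
    nlinarith

lemma aux_f_ne {V : Type} [Fintype V] (d : V → ℝ) (f : V → V → ℝ)
    (ho : ∀ k l, ∑ u, d u * f k u * f l u = if k = l then 1 else 0) (k : V) : f k ≠ 0 := by
  intro h
  have := ho k k
  simp [h] at this

lemma aux_lam_one_const {V : Type} [Fintype V] [Nontrivial V] (G : SimpleGraph V)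
    (hG : G.Connected) (lam : V → ℝ) (f : V → V → ℝ)
    (he : ∀ k u, ∑ v, lazyP G u v * f k v = lam k * f k u) (k : V) (hk : lam k = 1) (u v : V) :
    f k u = f k v := by
  apply aux_const G hG (f k)
  rw [aux_energy G hG]
  simp [he, hk]

lemma aux_lam_one_unique {V : Type} [Fintype V] [Nontrivial V] (G : SimpleGraph V)
    (hG : G.Connected) (lam : V → ℝ) (f : V → V → ℝ)
    (ho : ∀ k l, ∑ u, (G.degree u : ℝ) * f k u * f l u = if k = l then 1 else 0)
    (he : ∀ k u, ∑ v, lazyP G u v * f k v = lam k * f k u) (k l : V) (hk : lam k = 1)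
    (hl : lam l = 1) : k = l := by
  by_contra hkl
  have h1 := aux_lam_one_const G hG lam f he k hk
  have h2 := aux_lam_one_const G hG lam f he l hl
  have hkk := ho k k
  have hll := ho l l
  have hkl' := ho k l
  have u0 : V := k
  simp only [h1 _ u0, h2 _ u0, ← Finset.sum_mul, if_true, hkl, if_false] at hkk hll hkl'
  rcases mul_eq_zero.1 hkl' with h | h
  · rw [h] at hkk; simp at hkk
  · rw [h] at hll; simp at hll

lemma aux_mean_zero {V : Type} [Fintype V] [Nontrivial V] (G : SimpleGraph V)
    (hG : G.Connected) (r : ℝ) (h : V → ℝ) 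
    (he : ∀ u, ∑ v, lazyP G u v * h v = r * h u) (hr : r ≠ 1) :
    ∑ u, (G.degree u : ℝ) * h u = 0 := by
  have h1 : ∑ u, (G.degree u : ℝ) * ∑ v, lazyP G u v * h v = ∑ u, (G.degree u : ℝ) * h u := by
    simp only [Finset.mul_sum]
    rw [Finset.sum_comm]
    refine Finset.sum_congr rfl fun v _ => ?_
    simp only [← mul_assoc, aux_P_rev G hG _ v, ← Finset.sum_mul, ← Finset.mul_sum,
      aux_P_row G hG, mul_one]
  simp only [he] at h1
  have h2 : r * ∑ u, (G.degree u : ℝ) * h u = ∑ u, (G.degree u : ℝ) * h u := by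
    refine Eq.trans ?_ h1
    rw [Finset.mul_sum]
    refine Finset.sum_congr rfl fun u _ => ?_
    ring
  have : (r - 1) * ∑ u, (G.degree u : ℝ) * h u = 0 := by linarith
  exact (mul_eq_zero.1 this).resolve_left (sub_ne_zero.2 hr)

lemma aux_lam_one_exists {V : Type} [Fintype V] [Nontrivial V] (G : SimpleGraph V)
    (hG : G.Connected) (lam : V → ℝ) (f : V → V → ℝ)
    (hc : ∀ u v, ∑ k, f k u * f k v * (G.degree v : ℝ) = if u = v then 1 else 0)
    (he : ∀ k u, ∑ v, lazyP G u v * f k v = lam k * f k u) : ∃ k, lam k = 1 := by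
  by_contra hne
  push Not at hne
  obtain ⟨u⟩ : Nonempty V := inferInstance
  have h1 : ∑ v, ∑ k, f k u * f k v * (G.degree v : ℝ) = 1 := by
    simp [hc]
  rw [Finset.sum_comm] at h1
  have h2 : ∀ k, ∑ v, f k u * f k v * (G.degree v : ℝ) = 0 := by
    intro k
    have := aux_mean_zero G hG (lam k) (f k) (he k) (hne k)
    rw [← mul_zero (f k u), ← this, Finset.mul_sum]
    exact Finset.sum_congr rfl fun v _ => by ring
  simp [h2] at h1

lemma aux_gap {V : Type} [Fintype V] [Nontrivial V] (G : SimpleGraph V)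
    (hG : G.Connected) (lam : V → ℝ) (f : V → V → ℝ)
    (ho : ∀ k l, ∑ u, (G.degree u : ℝ) * f k u * f l u = if k = l then 1 else 0)
    (he : ∀ k u, ∑ v, lazyP G u v * f k v = lam k * f k u) :
    ∃ δ : ℝ, 0 < δ ∧ δ ≤ 1 ∧ (∀ k, lam k ≠ 1 → δ ≤ 1 - lam k) ∧ 1 / δ ≤ relTime (lazyP G) := by
  set A := {r : ℝ | r ≠ 1 ∧ ∃ f : V → ℝ, f ≠ 0 ∧ (lazyP G).mulVec f = r • f} with hA
  have hmem : ∀ k, lam k ≠ 1 → lam k ∈ A := by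
    intro k hk
    refine ⟨hk, f k, aux_f_ne _ f ho k, ?_⟩
    funext u
    exact he k u
  have hfin : A.Finite := by
    refine (Module.End.finite_hasEigenvalue (Matrix.toLin' (lazyP G))).subset ?_
    rintro r ⟨_, h, h0, hh⟩
    exact Module.End.hasEigenvalue_of_hasEigenvector (x := h)
      ⟨Module.End.mem_eigenspace_iff.2 (by rw [Matrix.toLin'_apply, hh]), h0⟩
  have hne : A.Nonempty := by
    obtain ⟨k, l, hkl⟩ := exists_pair_ne V
    by_cases hk : lam k = 1
    · by_cases hl : lam l = 1
      · exact absurd (aux_lam_one_unique G hG lam f ho he k l hk hl) hkl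
      · exact ⟨_, hmem l hl⟩
    · exact ⟨_, hmem k hk⟩
  have hs : secondEig (lazyP G) ∈ A := hne.csSup_mem hfin
  obtain ⟨h1, h, h0, hh⟩ := hs
  have hb := aux_eig_bounds G hG _ h h0 (fun u => congrFun hh u)
  have hlt : secondEig (lazyP G) < 1 := lt_of_le_of_ne hb.2 h1
  refine ⟨1 - secondEig (lazyP G), by linarith, by linarith, ?_, Nat.le_ceil _⟩
  intro k hk
  have : lam k ≤ secondEig (lazyP G) := le_csSup hfin.bddAbove (hmem k hk)
  linarith

lemma aux_pi_pos {V : Type} [Fintype V] [Nontrivial V] (G : SimpleGraph V)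
    (hG : G.Connected) : 0 < 2 * (numEdges G : ℝ) ∧ ∀ u, 0 < statDist G u := by
  have hm : 0 < 2 * (numEdges G : ℝ) := by
    rw [← aux_deg_total]
    exact Finset.sum_pos (fun u _ => aux_deg_pos G hG u) Finset.univ_nonempty
  exact ⟨hm, fun u => div_pos (aux_deg_pos G hG u) hm⟩

lemma aux_unif {V : Type} [Fintype V] [Nontrivial V] (G : SimpleGraph V)
    (hG : G.Connected) (t : ℕ) (ht : unifTime G ≤ t) (x y : V) :
    |(lazyP G ^ t) x y / statDist G y - 1| ≤ 1 / 4 := by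
  obtain ⟨lam, f, ho, hc, he⟩ := aux_spectral G hG
  obtain ⟨hm, hpi⟩ := aux_pi_pos G hG
  have hne : {t : ℕ | ∀ x y : V, |(lazyP G ^ t) x y / statDist G y - 1| ≤ 1 / 4}.Nonempty := by
    obtain ⟨k0, hk0⟩ := aux_lam_one_exists G hG lam f hc he
    have hconst := aux_lam_one_const G hG lam f he k0 hk0
    have hconv : ∀ x y, Filter.Tendsto (fun t => (lazyP G ^ t) x y / statDist G y - 1)
        Filter.atTop (nhds 0) := by
      intro x y
      have h1 : Filter.Tendsto (fun t => (lazyP G ^ t) x y) Filter.atTop (nhds (statDist G y)) := by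
        simp only [aux_pow (lazyP G) (fun u => (G.degree u : ℝ)) lam f hc he]
        have e : statDist G y = ∑ k, (if k = k0 then statDist G y else 0) := by simp
        rw [e]
        refine tendsto_finsetSum _ fun k _ => ?_
        by_cases hk : k = k0
        · subst hk
          simp only [hk0, one_pow, one_mul, if_true]
          have h2 := ho k k
          simp only [hconst _ y, ← Finset.sum_mul, aux_deg_total, if_true] at h2
          have : f k x * f k y * (G.degree y : ℝ) = statDist G y := by
            rw [hconst x y]; unfold statDist
            rw [eq_div_iff hm.ne']
            linear_combination (G.degree y : ℝ) * h2
          rw [this]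
          exact tendsto_const_nhds
        · simp only [hk, if_false]
          have hk1 : lam k ≠ 1 := fun h => hk (aux_lam_one_unique G hG lam f ho he k k0 h hk0)
          have hb := aux_eig_bounds G hG _ (f k) (aux_f_ne _ f ho k) (he k)
          have := (tendsto_pow_atTop_nhds_zero_of_lt_one hb.1 (lt_of_le_of_ne hb.2 hk1)).mul_const
            (f k x * f k y * (G.degree y : ℝ))
          simpa using this
      have h2 := (h1.div_const (statDist G y)).sub_const 1
      rwa [div_self (hpi y).ne', sub_self] at h2
    have hev : ∀ᶠ t in Filter.atTop, ∀ x y, |(lazyP G ^ t) x y / statDist G y - 1| ≤ 1 / 4 := by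
      rw [Filter.eventually_all]; intro x
      rw [Filter.eventually_all]; intro y
      have := (hconv x y).abs
      rw [abs_zero] at this
      exact (this.eventually_lt_const (by norm_num : (0:ℝ) < 1/4)).mono fun _ h => h.le
    exact hev.exists
  have h0 := Nat.sInf_mem hne
  change ∀ x y : V, |(lazyP G ^ (unifTime G)) x y / statDist G y - 1| ≤ 1 / 4 at h0
  clear hne
  revert x y
  induction t, ht using Nat.le_induction with
  | base => exact h0
  | succ t _ ih =>
    intro x y
    have e : (lazyP G ^ (t+1)) x y / statDist G y - 1 =
        ∑ z, lazyP G x z * ((lazyP G ^ t) z y / statDist G y - 1) := by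
      rw [pow_succ', Matrix.mul_apply]
      simp only [mul_sub, mul_one, Finset.sum_sub_distrib, aux_P_row G hG, Finset.sum_div, mul_div_assoc]
    rw [e]
    refine (Finset.abs_sum_le_sum_abs _ _).trans ?_
    calc ∑ z, |lazyP G x z * ((lazyP G ^ t) z y / statDist G y - 1)| 
        ≤ ∑ z, lazyP G x z * (1/4) := by
          refine Finset.sum_le_sum fun z _ => ?_
          rw [abs_mul, abs_of_nonneg (aux_P_nonneg G x z)]
          exact mul_le_mul_of_nonneg_left (ih z y) (aux_P_nonneg G x z)
      _ = 1/4 := by rw [← Finset.sum_mul, aux_P_row G hG, one_mul]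
lemma aux_path_bound {V : Type} [Fintype V] (G : SimpleGraph V) (hG : G.Connected)
    (h : V → ℝ) (u w : V) :
    (h u - h w) ^ 2 ≤ G.dist u w * (∑ u, ∑ v, if G.Adj u v then (h u - h v) ^ 2 else 0) := by
  obtain ⟨p, hp⟩ := (hG.preconnected u w).exists_walk_length_eq_dist
  have hpath := p.isPath_of_length_eq_dist hp
  have h1 : h u - h w = ∑ i ∈ Finset.range p.length, (h (p.getVert i) - h (p.getVert (i+1))) := by
    rw [Finset.sum_range_sub']
    simp
  rw [h1, ← hp]
  refine (sq_sum_le_card_mul_sum_sq).trans ?_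
  rw [Finset.card_range]
  refine mul_le_mul_of_nonneg_left ?_ (Nat.cast_nonneg _)
  have hn : ∀ a, 0 ≤ ∑ v, (if G.Adj a v then (h a - h v) ^ 2 else 0) :=
    fun a => Finset.sum_nonneg fun v _ => by split_ifs <;> positivity
  calc ∑ i ∈ Finset.range p.length, (h (p.getVert i) - h (p.getVert (i+1))) ^ 2 
      ≤ ∑ i ∈ Finset.range p.length, ∑ v,
          (if G.Adj (p.getVert i) v then (h (p.getVert i) - h v) ^ 2 else 0) := by
        refine Finset.sum_le_sum fun i hi => ?_
        have hadj := p.adj_getVert_succ (Finset.mem_range.1 hi)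
        have := Finset.single_le_sum (f := fun v =>
          (if G.Adj (p.getVert i) v then (h (p.getVert i) - h v) ^ 2 else 0))
          (fun v _ => by split_ifs <;> positivity) (Finset.mem_univ (p.getVert (i+1)))
        simpa [hadj] using this
    _ = ∑ a ∈ (Finset.range p.length).image p.getVert, ∑ v,
          (if G.Adj a v then (h a - h v) ^ 2 else 0) := by
        rw [Finset.sum_image]
        intro i hi j hj hij
        exact hpath.getVert_injOn (by simpa using (Finset.mem_range.1 hi).le)
          (by simpa using (Finset.mem_range.1 hj).le) hij
    _ ≤ _ := Finset.sum_le_sum_of_subset_of_nonneg (Finset.subset_univ _) fun a _ _ => hn a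

lemma aux_ball_card {V : Type} [Fintype V] (G : SimpleGraph V) (hG : G.Connected)
    (u w : V) (R : ℕ) (hw : R < G.dist u w) :
    R + 1 ≤ (Finset.univ.filter fun v => G.dist u v ≤ R).card := by
  obtain ⟨p, hp⟩ := (hG.preconnected u w).exists_walk_length_eq_dist
  have hpath := p.isPath_of_length_eq_dist hp
  have h1 : (Finset.range (R+1)).image p.getVert ⊆ Finset.univ.filter fun v => G.dist u v ≤ R := by
    intro v hv
    obtain ⟨i, hi, rfl⟩ := Finset.mem_image.1 hv
    simp only [Finset.mem_filter, Finset.mem_univ, true_and]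
    have := SimpleGraph.dist_le (p.take i)
    rw [SimpleGraph.Walk.take_length] at this
    have hi := Finset.mem_range.1 hi
    omega
  have h2 := Finset.card_le_card h1
  rwa [Finset.card_image_of_injOn, Finset.card_range] at h2
  intro i hi j hj hij
  have hi : i < R + 1 := by simpa using hi
  have hj : j < R + 1 := by simpa using hj
  exact hpath.getVert_injOn (by simp; omega) (by simp; omega) hij

lemma aux_big {V : Type} [Fintype V] [Nontrivial V] (G : SimpleGraph V) (hG : G.Connected)
    (K : V → V → ℝ) (δ τ : ℝ) (R : ℕ) (hδ : 0 < δ) (hτ : 0 < τ) (hR : 32 * R * δ ≤ τ)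
    (h2 : ∀ u, ∑ v, (G.degree v : ℝ) * K u v ^ 2 ≤ K u u)
    (h3 : ∀ u, (∑ a, ∑ b, if G.Adj a b then (K u a - K u b) ^ 2 else 0) ≤ 4 * δ * K u u)
    (h4 : ∀ u, ∑ v, (G.degree v : ℝ) * K u v = 0) :
    ∑ u ∈ Finset.univ.filter (fun u => τ ≤ K u u), (G.degree u : ℝ) * K u u ≤
      4 * Fintype.card V / (R + 1) := by
  have hd := aux_deg_pos G hG
  set B := Finset.univ.filter (fun u => τ ≤ K u u) with hB
  have hBm : ∀ u, u ∈ B ↔ τ ≤ K u u := by intro u; simp [hB]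
  have key : ∀ u ∈ B, ∀ w, G.dist u w ≤ 2 * R → K u u / 2 ≤ K u w := by
    intro u hu w hw
    have hu := (hBm u).1 hu
    have hp := aux_path_bound G hG (K u) u w
    have hw' : (G.dist u w : ℝ) ≤ 2 * R := by exact_mod_cast hw
    have h5 : (K u u - K u w) ^ 2 ≤ (K u u / 2) ^ 2 := by
      have e0 : 0 ≤ (∑ a, ∑ b, if G.Adj a b then (K u a - K u b) ^ 2 else 0) :=
        Finset.sum_nonneg fun u _ => Finset.sum_nonneg fun v _ => by split_ifs <;> positivity
      have hR0 : (0:ℝ) ≤ R := Nat.cast_nonneg _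
      calc (K u u - K u w) ^ 2 ≤ _ := hp
        _ ≤ (2 * R) * (4 * δ * K u u) := mul_le_mul hw' (h3 u) e0 (by positivity)
        _ = (32 * R * δ) * (K u u / 4) := by ring
        _ ≤ K u u * (K u u / 4) := by
            apply mul_le_mul_of_nonneg_right (hR.trans hu); linarith
        _ = _ := by ring
    have := abs_le_of_sq_le_sq h5 (by linarith)
    linarith [(abs_le.1 this).2]
  have vol : ∀ u ∈ B, K u u * ∑ v ∈ Finset.univ.filter (fun v => G.dist u v ≤ 2 * R),
      (G.degree v : ℝ) ≤ 4 := by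
    intro u hu
    have hu' := (hBm u).1 hu
    have hpos : 0 < K u u := lt_of_lt_of_le hτ hu'
    have h6 : ∑ v ∈ Finset.univ.filter (fun v => G.dist u v ≤ 2 * R),
        (G.degree v : ℝ) * (K u u / 2) ^ 2 ≤ K u u := by
      refine le_trans ?_ (h2 u)
      refine le_trans ?_ (Finset.sum_le_sum_of_subset_of_nonneg (Finset.subset_univ
        (Finset.univ.filter (fun v => G.dist u v ≤ 2 * R))) fun v _ _ => 
          mul_nonneg (hd v).le (sq_nonneg _))
      refine Finset.sum_le_sum fun v hv => ?_
      have := key u hu v (by simpa using hv)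
      gcongr
    rw [← Finset.sum_mul] at h6
    have : K u u * (K u u * ∑ v ∈ Finset.univ.filter (fun v => G.dist u v ≤ 2 * R),
        (G.degree v : ℝ)) ≤ K u u * 4 := by nlinarith
    exact le_of_mul_le_mul_left this hpos
  have far : ∀ u ∈ B, ((R:ℝ) + 1) ≤ ∑ w, if G.dist u w ≤ R then (1:ℝ) else 0 := by
    intro u hu
    have hu' := (hBm u).1 hu
    have hpos : 0 < K u u := lt_of_lt_of_le hτ hu'
    have : ∃ w, R < G.dist u w := by
      by_contra hcon
      push Not at hcon
      have : 0 < ∑ v, (G.degree v : ℝ) * K u v := by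
        refine Finset.sum_pos (fun v _ => mul_pos (hd v) ?_) Finset.univ_nonempty
        have := key u hu v (by have := hcon v; omega)
        linarith
      linarith [h4 u]
    obtain ⟨w, hw⟩ := this
    rw [Finset.sum_boole]
    exact_mod_cast aux_ball_card G hG u w R hw
  have hw : ∀ w, ∑ u ∈ B, (if G.dist u w ≤ R then (G.degree u : ℝ) * K u u else 0) ≤ 4 := by
    intro w
    rw [← Finset.sum_filter]
    rcases (B.filter fun u => G.dist u w ≤ R).eq_empty_or_nonempty with h | h
    · rw [h]; simp
    · obtain ⟨u0, hu0, hmax⟩ := Finset.exists_max_image _ (fun u => K u u) h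
      simp only [Finset.mem_filter] at hu0 hmax
      refine le_trans ?_ (vol u0 hu0.1)
      rw [Finset.mul_sum]
      have hpos : 0 < K u0 u0 := lt_of_lt_of_le hτ ((hBm u0).1 hu0.1)
      calc ∑ u ∈ B.filter fun u => G.dist u w ≤ R, (G.degree u : ℝ) * K u u 
          ≤ ∑ u ∈ B.filter fun u => G.dist u w ≤ R, K u0 u0 * (G.degree u : ℝ) := by
            refine Finset.sum_le_sum fun u hu => ?_
            rw [mul_comm]
            exact mul_le_mul_of_nonneg_right (hmax u (by simpa using hu)) (hd u).le
        _ ≤ _ := by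
            refine Finset.sum_le_sum_of_subset_of_nonneg ?_ fun v _ _ =>
              mul_nonneg hpos.le (hd v).le
            intro u hu
            simp only [Finset.mem_filter, Finset.mem_univ, true_and] at hu ⊢
            have h7 := hG.dist_triangle (u := u0) (v := w) (w := u)
            have h8 := G.dist_comm (u := w) (v := u)
            omega
  rw [le_div_iff₀ (by positivity)]
  calc (∑ u ∈ B, (G.degree u : ℝ) * K u u) * ((R:ℝ) + 1) 
      ≤ ∑ u ∈ B, ∑ w, (if G.dist u w ≤ R then (G.degree u : ℝ) * K u u else 0) := by
        rw [Finset.sum_mul]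
        refine Finset.sum_le_sum fun u hu => ?_
        have hpos : 0 < K u u := lt_of_lt_of_le hτ ((hBm u).1 hu)
        refine (mul_le_mul_of_nonneg_left (far u hu) (mul_nonneg (hd u).le hpos.le)).trans ?_
        rw [Finset.mul_sum]
        refine le_of_eq (Finset.sum_congr rfl fun w _ => ?_)
        split_ifs <;> simp
    _ = ∑ w, ∑ u ∈ B, (if G.dist u w ≤ R then (G.degree u : ℝ) * K u u else 0) :=
        Finset.sum_comm
    _ ≤ ∑ w : V, 4 := Finset.sum_le_sum fun w _ => hw w
    _ = _ := by simp [mul_comm]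

lemma aux_small {V : Type} [Fintype V] [Nontrivial V] (G : SimpleGraph V) (hG : G.Connected)
    (b : V → ℝ) (f : V → V → ℝ) (K q : V → V → ℝ) (δ β : ℝ) (hβ : 0 < β)
    (hb : ∀ k, 0 ≤ b k)
    (hK : ∀ u v, K u v = ∑ k, b k * f k u * f k v)
    (hq : ∀ u v, q u v = ∑ k, b k * (f k u - f k v) ^ 2)
    (h2 : ∀ u, ∑ v, (G.degree v : ℝ) * K u v ^ 2 ≤ K u u)
    (h5 : (∑ u, ∑ v, if G.Adj u v then q u v else 0) ≤ 4 * δ * Fintype.card V) :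
    ∑ u ∈ Finset.univ.filter (fun u => ¬ (β ^ 2 ≤ K u u)), (G.degree u : ℝ) * K u u ≤
      136 * δ * Fintype.card V + 17 / 2 * β * Fintype.card V := by
  have hq0 : ∀ u v, 0 ≤ q u v := by
    intro u v; rw [hq]; exact Finset.sum_nonneg fun k _ => mul_nonneg (hb k) (sq_nonneg _)
  have hr0 : ∀ u, 0 ≤ K u u := by
    intro u; rw [hK]; refine Finset.sum_nonneg fun k _ => ?_
    rw [mul_assoc]; exact mul_nonneg (hb k) (mul_self_nonneg _)
  have hsym : ∀ u v, q u v = q v u := by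
    intro u v; rw [hq, hq]; exact Finset.sum_congr rfl fun k _ => by ring
  have hr2 : ∀ u v, K u u ≤ 2 * K v v + 2 * q u v := by
    intro u v
    rw [hK, hK, hq, Finset.mul_sum, Finset.mul_sum, ← Finset.sum_add_distrib]
    refine Finset.sum_le_sum fun k _ => ?_
    nlinarith [mul_nonneg (hb k) (sq_nonneg (f k u - 2 * f k v))]
  have hq3 : ∀ u v w, q u w ≤ 2 * q u v + 2 * q v w := by
    intro u v w
    rw [hq, hq, hq, Finset.mul_sum, Finset.mul_sum, ← Finset.sum_add_distrib]
    refine Finset.sum_le_sum fun k _ => ?_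
    nlinarith [mul_nonneg (hb k) (sq_nonneg (f k u - 2 * f k v + f k w))]
  have hpol : ∀ u w, 2 * K u w = K u u + K w w - q u w := by
    intro u w
    rw [hK, hK, hK, hq, Finset.mul_sum, ← Finset.sum_add_distrib, ← Finset.sum_sub_distrib]
    exact Finset.sum_congr rfl fun k _ => by ring
  let A : V → V → Prop := fun u v => G.Adj u v ∧ q u v ≤ K u u / 16 ∧ q u v ≤ K v v / 16
  have hAs : ∀ u v, A u v → A v u := by
    rintro u v ⟨h1, h2, h3⟩
    exact ⟨h1.symm, by rw [hsym]; exact h3, by rw [hsym]; exact h2⟩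
  let gi : V → V → ℝ := fun u v => if A u v then 1 else 0
  have gi0 : ∀ u v, 0 ≤ gi u v := by intro u v; simp only [gi]; split_ifs <;> norm_num
  have gis : ∀ u v, gi u v = gi v u := by
    intro u v; simp only [gi]
    have : A u v ↔ A v u := ⟨hAs u v, hAs v u⟩
    simp [this]
  let g : V → ℝ := fun u => ∑ v, gi u v
  have g0 : ∀ u, 0 ≤ g u := fun u => Finset.sum_nonneg fun v _ => gi0 u v
  have gd : ∀ u, g u ≤ G.degree u := by
    intro u
    rw [← aux_deg_sum]
    refine Finset.sum_le_sum fun v _ => ?_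
    simp only [gi]
    by_cases h : G.Adj u v
    · rw [if_pos h]; split_ifs <;> norm_num
    · have : ¬ A u v := fun hA => h hA.1
      rw [if_neg h, if_neg this]
  have chain : ∀ u v w, A u v → A v w → K u u / 4 ≤ K u w := by
    intro u v w huv hvw
    have e1 := hpol u w
    have e2 := hq3 u v w
    have e3 := hr2 v u
    rw [hsym v u] at e3
    have e4 := huv.2.1
    have e5 := hvw.2.1
    have e6 := hr0 w
    have e7 := hr0 u
    linarith
  have two : ∀ u, K u u ^ 2 * ∑ v, gi u v * g v ≤ 16 * K u u := by
    intro u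
    calc K u u ^ 2 * ∑ v, gi u v * g v = ∑ w, ∑ v, gi u v * gi v w * K u u ^ 2 := by
          simp only [g, Finset.mul_sum]
          rw [Finset.sum_comm]
          exact Finset.sum_congr rfl fun w _ => Finset.sum_congr rfl fun v _ => by ring
      _ ≤ ∑ w, ∑ v, gi w v * (16 * K u w ^ 2) := by
          refine Finset.sum_le_sum fun w _ => Finset.sum_le_sum fun v _ => ?_
          rw [gis w v]
          by_cases h1 : A u v
          · by_cases h2 : A v w
            · have h3 := chain u v w h1 h2
              have h4 := hr0 u
              simp only [gi, h1, h2, if_true]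
              nlinarith
            · simp [gi, h2]
          · have : gi u v = 0 := by simp [gi, h1]
            rw [this]
            have := gi0 v w
            simp only [zero_mul]
            positivity
      _ ≤ ∑ w, 16 * ((G.degree w : ℝ) * K u w ^ 2) := by
          refine Finset.sum_le_sum fun w _ => ?_
          rw [← Finset.sum_mul]
          have := mul_le_mul_of_nonneg_right (gd w) (by positivity : 0 ≤ 16 * K u w ^ 2)
          simp only [g] at this
          linarith
      _ ≤ 16 * K u u := by
          rw [← Finset.mul_sum]; exact mul_le_mul_of_nonneg_left (h2 u) (by norm_num)
  have pt : ∀ u v, (if G.Adj u v then (1:ℝ) else 0) * K u u ≤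
      34 * (if G.Adj u v then q u v else 0) + gi u v * K u u := by
    intro u v
    by_cases h : G.Adj u v
    · simp only [h, if_true]
      by_cases hA : A u v
      · simp only [gi, hA, if_true]; linarith [hq0 u v]
      · simp only [gi, hA, if_false]
        have e1 := hr2 u v
        have e2 := hq0 u v
        by_cases h6 : q u v ≤ K u u / 16
        · have h7 : ¬ q u v ≤ K v v / 16 := fun h7 => hA ⟨h, h6, h7⟩
          linarith
        · linarith
    · simp only [h, if_false]
      linarith [mul_nonneg (gi0 u v) (hr0 u)]
  have pt2 : ∀ u v, gi u v * K u u ≤ (1 / (2 * β)) * (K u u ^ 2 * (gi u v * g v)) +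
      β / 2 * (gi u v / g v) := by
    intro u v
    by_cases hA : A u v
    · have e : gi u v = 1 := by simp [gi, hA]
      have hg : 0 < g v := by
        have := Finset.single_le_sum (f := fun w => gi v w) (fun w _ => gi0 v w) (Finset.mem_univ u)
        simp only [gis v u, e] at this
        exact lt_of_lt_of_le one_pos this
      rw [e]
      have : (1 / (2 * β)) * (K u u ^ 2 * (1 * g v)) + β / 2 * (1 / g v) - 1 * K u u = 
        (K u u * g v - β) ^ 2 / (2 * β * g v) := by
        field_simp; ring
      have h9 : 0 ≤ (K u u * g v - β) ^ 2 / (2 * β * g v) := by positivity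
      linarith
    · have e : gi u v = 0 := by simp [gi, hA]
      rw [e]; simp
  set S := Finset.univ.filter (fun u => ¬ (β ^ 2 ≤ K u u)) with hS
  calc ∑ u ∈ S, (G.degree u : ℝ) * K u u 
      = ∑ u ∈ S, ∑ v, (if G.Adj u v then (1:ℝ) else 0) * K u u := by
        refine Finset.sum_congr rfl fun u _ => ?_
        rw [← Finset.sum_mul, aux_deg_sum]
    _ ≤ ∑ u ∈ S, ∑ v, (34 * (if G.Adj u v then q u v else 0) +
          ((1 / (2 * β)) * (K u u ^ 2 * (gi u v * g v)) + β / 2 * (gi u v / g v))) :=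
        Finset.sum_le_sum fun u _ => Finset.sum_le_sum fun v _ =>
          (pt u v).trans (by linarith [pt2 u v])
    _ = 34 * (∑ u ∈ S, ∑ v, (if G.Adj u v then q u v else 0)) +
          ((1 / (2 * β)) * (∑ u ∈ S, K u u ^ 2 * ∑ v, gi u v * g v) + 
          β / 2 * (∑ u ∈ S, ∑ v, gi u v / g v)) := by
        simp only [Finset.sum_add_distrib, Finset.mul_sum]
    _ ≤ 34 * (4 * δ * Fintype.card V) + ((1 / (2 * β)) * (16 * β ^ 2 * Fintype.card V) +
          β / 2 * Fintype.card V) := by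
        gcongr
        · refine le_trans ?_ h5
          exact Finset.sum_le_sum_of_subset_of_nonneg (Finset.subset_univ _) fun u _ _ =>
            Finset.sum_nonneg fun v _ => by
              have := hq0 u v
              split_ifs <;> simp [this]
        · calc ∑ u ∈ S, K u u ^ 2 * ∑ v, gi u v * g v ≤ ∑ u ∈ S, 16 * β ^ 2 := by
                refine Finset.sum_le_sum fun u hu => ?_
                have hu : ¬ (β ^ 2 ≤ K u u) := by simpa [hS] using hu
                linarith [two u]
            _ ≤ ∑ u : V, 16 * β ^ 2 := 
                Finset.sum_le_sum_of_subset_of_nonneg (Finset.subset_univ _) fun u _ _ => by positivity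
            _ = _ := by simp [mul_comm]
        · calc ∑ u ∈ S, ∑ v, gi u v / g v ≤ ∑ u, ∑ v, gi u v / g v := 
                Finset.sum_le_sum_of_subset_of_nonneg (Finset.subset_univ _) fun u _ _ => 
                  Finset.sum_nonneg fun v _ => div_nonneg (gi0 u v) (g0 v)
            _ = ∑ v, g v / g v := by
                rw [Finset.sum_comm]
                refine Finset.sum_congr rfl fun v _ => ?_
                rw [← Finset.sum_div]
                simp only [gis _ v, g]
            _ ≤ ∑ v : V, 1 := Finset.sum_le_sum fun v _ => div_self_le_one _
            _ = _ := by simp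
    _ = _ := by field_simp; ring

/-- the key spectral estimate -/
lemma aux_core {V : Type} [Fintype V] [Nontrivial V] (G : SimpleGraph V) (hG : G.Connected)
    (lam : V → ℝ) (f : V → V → ℝ)
    (ho : ∀ k l, ∑ u, (G.degree u : ℝ) * f k u * f l u = if k = l then 1 else 0)
    (he : ∀ k u, ∑ v, lazyP G u v * f k v = lam k * f k u)
    (β : ℝ) (hβ : 0 < β) (hβ1 : β ≤ 1) (hgap : ∀ k, lam k ≠ 1 → β ^ 3 ≤ 1 - lam k) :
    ∑ k, (if lam k = 1 then 0 else 1 / (1 - lam k) ^ 2) ≤ 300 * Fintype.card V / β ^ 5 := by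
  have hd := aux_deg_pos G hG
  set δ := β ^ 3 with hδdef
  have hδ : 0 < δ := by positivity
  let a : V → ℝ := fun k => if lam k = 1 then 0 else δ / (1 - lam k)
  have ha : ∀ k, 0 ≤ a k ∧ a k ≤ 1 ∧ a k * (1 - lam k) ≤ δ ∧ 0 ≤ 1 - lam k := by
    intro k
    by_cases h : lam k = 1
    · simp [a, h, hδ.le]
    · have h1 := hgap k h
      have h2 : 0 < 1 - lam k := lt_of_lt_of_le hδ h1
      simp only [a, h, if_false]
      refine ⟨by positivity, (div_le_one h2).2 h1, ?_, h2.le⟩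
      rw [div_mul_cancel₀ _ h2.ne']
  let b : V → ℝ := fun k => a k ^ 2
  let K : V → V → ℝ := fun u v => ∑ k, b k * f k u * f k v
  let q : V → V → ℝ := fun u v => ∑ k, b k * (f k u - f k v) ^ 2
  have hKuu : ∀ u, K u u = ∑ k, a k ^ 2 * f k u ^ 2 := by
    intro u; exact Finset.sum_congr rfl fun k _ => by simp only [b]; ring
  have h2 : ∀ u, ∑ v, (G.degree v : ℝ) * K u v ^ 2 ≤ K u u := by
    intro u
    have := aux_parseval (fun v => (G.degree v : ℝ)) f ho (fun k => b k * f k u)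
      (fun k => b k * f k u)
    calc ∑ v, (G.degree v : ℝ) * K u v ^ 2 = ∑ k, b k * f k u * (b k * f k u) := by
          rw [← this]; refine Finset.sum_congr rfl fun v _ => by simp only [K]; ring
      _ ≤ K u u := by
          refine Finset.sum_le_sum fun k _ => ?_
          obtain ⟨h1, h2, -, -⟩ := ha k
          have hb0 : 0 ≤ b k := sq_nonneg _
          have hb1 : b k ≤ 1 := by simp only [b]; nlinarith
          have : b k * f k u * (b k * f k u) = b k * (b k * f k u * f k u) := by ring
          rw [this]
          have h5 : 0 ≤ b k * f k u * f k u := by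
            rw [mul_assoc]; exact mul_nonneg hb0 (mul_self_nonneg _)
          nlinarith
  have h3 : ∀ u, (∑ x, ∑ y, if G.Adj x y then (K u x - K u y) ^ 2 else 0) ≤ 4 * δ * K u u := by
    intro u
    have := aux_energy_sum G hG lam f ho he (fun k => b k * f k u)
    rw [this, mul_assoc]
    refine mul_le_mul_of_nonneg_left ?_ (by norm_num)
    rw [Finset.mul_sum]
    refine Finset.sum_le_sum fun k _ => ?_
    obtain ⟨h1, h2, h3, h4⟩ := ha k
    have e : (b k * f k u) ^ 2 * (1 - lam k) = (a k ^ 2 * f k u ^ 2) * (a k * (a k * (1 - lam k))) := by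
      simp only [b]; ring
    have e2 : δ * (b k * f k u * f k u) = (a k ^ 2 * f k u ^ 2) * δ := by simp only [b]; ring
    rw [e, e2]
    refine mul_le_mul_of_nonneg_left ?_ (by positivity)
    nlinarith [mul_nonneg h1 h4]
  have h4 : ∀ u, ∑ v, (G.degree v : ℝ) * K u v = 0 := by
    intro u
    simp only [K, Finset.mul_sum]
    rw [Finset.sum_comm]
    refine Finset.sum_eq_zero fun k _ => ?_
    by_cases h : lam k = 1
    · simp [b, a, h]
    · have := aux_mean_zero G hG (lam k) (f k) (he k) h
      rw [← mul_zero (b k * f k u), ← this, Finset.mul_sum]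
      exact Finset.sum_congr rfl fun v _ => by ring
  have h5 : (∑ u, ∑ v, if G.Adj u v then q u v else 0) ≤ 4 * δ * Fintype.card V := by
    have e1 : ∀ k, (∑ u, ∑ v, if G.Adj u v then (f k u - f k v) ^ 2 else 0) = 4 * (1 - lam k) := by
      intro k
      have := aux_energy_sum G hG lam f ho he (fun l => if l = k then 1 else 0)
      simpa using this
    have e2 : (∑ u, ∑ v, if G.Adj u v then q u v else 0) = 
        ∑ k, b k * (∑ u, ∑ v, if G.Adj u v then (f k u - f k v) ^ 2 else 0) := by
      simp only [Finset.mul_sum]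
      rw [Finset.sum_comm]
      rw [Finset.sum_comm (s := (Finset.univ : Finset V)) (t := (Finset.univ : Finset V))]
      rw [Finset.sum_comm (γ := V) (f := fun k u => ∑ v, b k * if G.Adj u v then (f k u - f k v) ^ 2 else 0)]
      refine Finset.sum_congr rfl fun u _ => ?_
      rw [Finset.sum_comm]
      refine Finset.sum_congr rfl fun v _ => ?_
      split_ifs
      · rfl
      · simp
    rw [e2]
    calc ∑ k, b k * (∑ u, ∑ v, if G.Adj u v then (f k u - f k v) ^ 2 else 0) 
        ≤ ∑ k : V, 4 * δ := by
          refine Finset.sum_le_sum fun k _ => ?_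
          rw [e1]
          obtain ⟨h1, h2, h3, h4⟩ := ha k
          have : b k * (4 * (1 - lam k)) = 4 * (a k * (a k * (1 - lam k))) := by
            simp only [b]; ring
          rw [this]
          nlinarith [mul_nonneg h1 h4]
      _ = _ := by simp; ring
  have small := aux_small G hG b f K q δ β hβ (fun k => sq_nonneg _) (fun _ _ => rfl)
    (fun _ _ => rfl) h2 h5
  have hR : 32 * (⌊1 / (32 * β)⌋₊ : ℝ) * δ ≤ β ^ 2 := by
    have := Nat.floor_le (by positivity : 0 ≤ 1 / (32 * β))
    calc 32 * (⌊1 / (32 * β)⌋₊ : ℝ) * δ ≤ 32 * (1 / (32 * β)) * δ := by gcongr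
      _ = β ^ 2 := by rw [hδdef]; field_simp
  have big := aux_big G hG K δ (β ^ 2) ⌊1 / (32 * β)⌋₊ hδ (by positivity) hR h2 h3 h4
  have big2 : 4 * (Fintype.card V : ℝ) / (⌊1 / (32 * β)⌋₊ + 1) ≤ 128 * β * Fintype.card V := by
    have := (Nat.lt_floor_add_one (1 / (32 * β))).le
    calc 4 * (Fintype.card V : ℝ) / (⌊1 / (32 * β)⌋₊ + 1) 
        ≤ 4 * (Fintype.card V : ℝ) / (1 / (32 * β)) := by gcongr
      _ = _ := by field_simp; norm_num
  have tot : ∑ u, (G.degree u : ℝ) * K u u = ∑ k, b k := by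
    simp only [K, Finset.mul_sum]
    rw [Finset.sum_comm]
    refine Finset.sum_congr rfl fun k _ => ?_
    have := ho k k
    rw [if_pos rfl] at this
    calc ∑ v, (G.degree v : ℝ) * (b k * f k v * f k v) 
        = b k * ∑ v, (G.degree v : ℝ) * f k v * f k v := by
          rw [Finset.mul_sum]; exact Finset.sum_congr rfl fun v _ => by ring
      _ = b k := by rw [this, mul_one]
  have hfin : ∑ k, b k ≤ 300 * Fintype.card V * β := by
    rw [← tot, ← Finset.sum_filter_add_sum_filter_not Finset.univ (fun u => β ^ 2 ≤ K u u)]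
    have hδβ : δ ≤ β := by
      rw [hδdef]; calc β ^ 3 ≤ β ^ 1 := pow_le_pow_of_le_one hβ.le hβ1 (by norm_num)
        _ = β := pow_one β
    have hn : (0:ℝ) ≤ Fintype.card V := Nat.cast_nonneg _
    nlinarith [mul_le_mul_of_nonneg_right hδβ hn, mul_nonneg hβ.le hn]
  have e : ∀ k, (if lam k = 1 then 0 else 1 / (1 - lam k) ^ 2) = b k / δ ^ 2 := by
    intro k
    simp only [b, a]
    split_ifs with h
    · simp
    · have h2 : 1 - lam k ≠ 0 := fun h3 => h (by linarith)
      field_simp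
  simp only [e]
  rw [← Finset.sum_div, div_le_div_iff₀ (by positivity) (by positivity)]
  calc (∑ k, b k) * β ^ 5 ≤ (300 * Fintype.card V * β) * β ^ 5 := by gcongr
    _ = _ := by rw [hδdef]; ring
lemma aux_inter {V : Type} [Fintype V] [Nonempty V] (G : SimpleGraph V)
    (a b : ℕ) {T : ℕ} (p q : Fin T → V) :
    wInterIco G a b p q = ∑ u, (1 / (G.degree u : ℝ)) *
      ((∑ i ∈ Finset.Ico a b, if traj p i = u then (1:ℝ) else 0) *
       (∑ i ∈ Finset.Ico a b, if traj q i = u then (1:ℝ) else 0)) := by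
  unfold wInterIco
  simp only [Finset.sum_mul_sum]
  simp only [Finset.mul_sum]
  symm
  rw [Finset.sum_comm]
  refine Finset.sum_congr rfl fun i _ => ?_
  rw [Finset.sum_comm]
  refine Finset.sum_congr rfl fun j _ => ?_
  rw [Finset.sum_eq_single (traj p i)]
  · simp [eq_comm]
  · intro u _ hu
    simp [Ne.symm hu]
  · simp

lemma aux_E1 {Ω V : Type} [Fintype Ω] [Fintype V] (w : Ω → ℝ) (L : Ω → V → ℝ) (e : V → ℝ) :
    ∑ p, ∑ q, w p * w q * (∑ u, e u * (L p u * L q u)) = ∑ u, e u * (∑ p, w p * L p u) ^ 2 := by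
  have h1 : ∀ u, e u * (∑ p, w p * L p u) ^ 2 = ∑ p, ∑ q, w p * w q * (e u * (L p u * L q u)) := by
    intro u
    rw [sq, Finset.sum_mul_sum, Finset.mul_sum]
    refine Finset.sum_congr rfl fun p _ => ?_
    rw [Finset.mul_sum]
    exact Finset.sum_congr rfl fun q _ => by ring
  simp only [h1, Finset.mul_sum]
  symm
  rw [Finset.sum_comm]
  refine Finset.sum_congr rfl fun p _ => ?_
  rw [Finset.sum_comm]

lemma aux_E2 {Ω V : Type} [Fintype Ω] [Fintype V] (w : Ω → ℝ) (L : Ω → V → ℝ) (e : V → ℝ) :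
    ∑ p, ∑ q, w p * w q * (∑ u, e u * (L p u * L q u)) ^ 2 =
      ∑ u, ∑ v, e u * e v * (∑ p, w p * (L p u * L p v)) ^ 2 := by
  have := aux_E1 w (fun p (x : V × V) => L p x.1 * L p x.2) (fun x => e x.1 * e x.2)
  simp only [Fintype.sum_prod_type] at this
  rw [← this]
  refine Finset.sum_congr rfl fun p _ => Finset.sum_congr rfl fun q _ => ?_
  congr 1
  rw [sq, Finset.sum_mul_sum]
  exact Finset.sum_congr rfl fun u _ => Finset.sum_congr rfl fun v _ => by ring

lemma aux_shift (φ : ℕ → ℝ) (hφ : ∀ s, 0 ≤ φ s) (U t i : ℕ) (hi : i ∈ Finset.Ico U (U+t)) :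
    ∑ k ∈ Finset.Ico U (U+t), φ ((k - i) + (i - k)) ≤ 2 * ∑ s ∈ Finset.range t, φ s := by
  rw [Finset.mem_Ico] at hi
  have h1 : ∑ k ∈ (Finset.Ico U (U+t)).filter (fun k => i ≤ k), φ ((k - i) + (i - k)) ≤
      ∑ s ∈ Finset.range t, φ s := by
    rw [← Finset.sum_image (f := φ) (g := fun k => (k - i) + (i - k))]
    · refine Finset.sum_le_sum_of_subset_of_nonneg ?_ fun s _ _ => hφ s
      intro s hs
      obtain ⟨k, hk, rfl⟩ := Finset.mem_image.1 hs
      simp only [Finset.mem_filter, Finset.mem_Ico] at hk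
      rw [Finset.mem_range]; omega
    · intro k hk l hl hkl
      simp only [Finset.coe_filter, Finset.mem_Ico, Set.mem_ofPred_eq] at hk hl hkl
      omega
  have h2 : ∑ k ∈ (Finset.Ico U (U+t)).filter (fun k => ¬ i ≤ k), φ ((k - i) + (i - k)) ≤
      ∑ s ∈ Finset.range t, φ s := by
    rw [← Finset.sum_image (f := φ) (g := fun k => (k - i) + (i - k))]
    · refine Finset.sum_le_sum_of_subset_of_nonneg ?_ fun s _ _ => hφ s
      intro s hs
      obtain ⟨k, hk, rfl⟩ := Finset.mem_image.1 hs
      simp only [Finset.mem_filter, Finset.mem_Ico] at hk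
      rw [Finset.mem_range]; omega
    · intro k hk l hl hkl
      simp only [Finset.coe_filter, Finset.mem_Ico, Set.mem_ofPred_eq] at hk hl hkl
      omega
  rw [← Finset.sum_filter_add_sum_filter_not _ (fun k => i ≤ k)]
  linarith

lemma aux_pow_nonneg {V : Type} [Fintype V] (P : Matrix V V ℝ) (hP : ∀ u v, 0 ≤ P u v) (i : ℕ) :
    ∀ u v, 0 ≤ (P ^ i) u v := by
  induction i with
  | zero => intro u v; simp only [pow_zero, Matrix.one_apply]; split_ifs <;> norm_num
  | succ i ih =>
    intro u v
    rw [pow_succ', Matrix.mul_apply]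
    exact Finset.sum_nonneg fun w _ => mul_nonneg (hP _ _) (ih _ _)

lemma aux_pow_row {V : Type} [Fintype V] (P : Matrix V V ℝ) (hP : ∀ u, ∑ v, P u v = 1) (i : ℕ) :
    ∀ u, ∑ v, (P ^ i) u v = 1 := by
  induction i with
  | zero => intro u; simp [Matrix.one_apply]
  | succ i ih =>
    intro u
    simp only [pow_succ', Matrix.mul_apply]
    rw [Finset.sum_comm]
    simp only [← Finset.mul_sum, ih, mul_one, hP]

lemma aux_moment1 {V : Type} [Fintype V] [Nonempty V] (P : Matrix V V ℝ)
    (hP : ∀ u, ∑ v, P u v = 1) (x : V) (U t : ℕ) (u : V) :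
    ∑ p : Fin (U+t) → V, pathWeight P x (U+t) p *
      (∑ i ∈ Finset.Ico U (U+t), if traj p i = u then (1:ℝ) else 0) =
    ∑ i ∈ Finset.Ico U (U+t), (P ^ i) x u := by
  simp only [Finset.mul_sum]
  rw [Finset.sum_comm]
  refine Finset.sum_congr rfl fun i hi => ?_
  rw [Finset.mem_Ico] at hi
  obtain ⟨T, hT⟩ : ∃ T, U + t = T + 1 := ⟨U + t - 1, by omega⟩
  rw [hT]
  have := aux_one P hP (fun z => if z = u then 1 else 0) T i x (by omega)
  simpa using this

lemma aux_moment2 {V : Type} [Fintype V] [Nontrivial V] (G : SimpleGraph V) (hG : G.Connected)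
    (x : V) (t : ℕ) (u v : V)
    (hrev : ∀ (i : ℕ) (u v : V), statDist G u * (lazyP G ^ i) u v = statDist G v * (lazyP G ^ i) v u)
    (hu : ∀ i, unifTime G ≤ i → ∀ u, (lazyP G ^ i) x u ≤ 5 / 4 * statDist G u) :
    ∑ p : Fin (unifTime G+t) → V, pathWeight (lazyP G) x (unifTime G+t) p *
      ((∑ i ∈ Finset.Ico (unifTime G) (unifTime G+t), if traj p i = u then (1:ℝ) else 0) *
       (∑ i ∈ Finset.Ico (unifTime G) (unifTime G+t), if traj p i = v then (1:ℝ) else 0)) ≤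
    5 / 2 * t * (statDist G u * ∑ s ∈ Finset.range t, (lazyP G ^ s) u v) := by
  set U := unifTime G
  have hP := aux_P_row G hG
  have hpi := (aux_pi_pos G hG).2
  have hnn := fun i => aux_pow_nonneg (lazyP G) (aux_P_nonneg G) i
  have e1 : ∑ p : Fin (U+t) → V, pathWeight (lazyP G) x (U+t) p *
      ((∑ i ∈ Finset.Ico U (U+t), if traj p i = u then (1:ℝ) else 0) *
       (∑ i ∈ Finset.Ico U (U+t), if traj p i = v then (1:ℝ) else 0)) =
      ∑ i ∈ Finset.Ico U (U+t), ∑ k ∈ Finset.Ico U (U+t), 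
        ∑ p : Fin (U+t) → V, pathWeight (lazyP G) x (U+t) p * 
          ((if traj p i = u then (1:ℝ) else 0) * (if traj p k = v then (1:ℝ) else 0)) := by
    simp only [Finset.sum_mul_sum]
    simp only [Finset.mul_sum]
    rw [Finset.sum_comm]
    refine Finset.sum_congr rfl fun i _ => ?_
    rw [Finset.sum_comm]
  have e2 : ∀ i ∈ Finset.Ico U (U+t), ∀ k ∈ Finset.Ico U (U+t), 
        ∑ p : Fin (U+t) → V, pathWeight (lazyP G) x (U+t) p * 
          ((if traj p i = u then (1:ℝ) else 0) * (if traj p k = v then (1:ℝ) else 0)) ≤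
        5 / 4 * statDist G u * (lazyP G ^ ((k - i) + (i - k))) u v := by
    intro i hi k hk
    rw [Finset.mem_Ico] at hi hk
    obtain ⟨T, hT⟩ : ∃ T, U + t = T + 1 := ⟨U + t - 1, by omega⟩
    rw [hT]
    rcases le_total i k with h | h
    · obtain ⟨j, rfl⟩ := Nat.exists_eq_add_of_le h
      have := aux_two (lazyP G) hP (fun z => if z = u then 1 else 0) (fun z => if z = v then 1 else 0)
        T i j x (by omega)
      rw [this]
      simp only [ite_mul, one_mul, zero_mul, mul_ite, mul_one, mul_zero, Finset.sum_ite_eq',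
        Finset.mem_univ, if_true]
      have e : i + j - i + (i - (i + j)) = j := by omega
      rw [e]
      exact mul_le_mul_of_nonneg_right (hu i hi.1 u) (hnn j u v)
    · obtain ⟨j, rfl⟩ := Nat.exists_eq_add_of_le h
      have := aux_two (lazyP G) hP (fun z => if z = v then 1 else 0) (fun z => if z = u then 1 else 0)
        T k j x (by omega)
      have e3 : ∀ p : Fin (T+1) → V, 
        ((if traj p (k+j) = u then (1:ℝ) else 0) * (if traj p k = v then (1:ℝ) else 0)) =
        ((if traj p k = v then (1:ℝ) else 0) * (if traj p (k+j) = u then (1:ℝ) else 0)) :=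
        fun p => mul_comm _ _
      simp only [e3]
      rw [this]
      simp only [ite_mul, one_mul, zero_mul, mul_ite, mul_one, mul_zero, Finset.sum_ite_eq',
        Finset.mem_univ, if_true]
      have e : k - (k + j) + ((k + j) - k) = j := by omega
      rw [e, mul_assoc, hrev, ← mul_assoc]
      exact mul_le_mul_of_nonneg_right (hu k hk.1 v) (hnn j v u)
  rw [e1]
  calc _ ≤ ∑ i ∈ Finset.Ico U (U+t), ∑ k ∈ Finset.Ico U (U+t), 
        5 / 4 * statDist G u * (lazyP G ^ ((k - i) + (i - k))) u v :=
        Finset.sum_le_sum fun i hi => Finset.sum_le_sum fun k hk => e2 i hi k hk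
    _ ≤ ∑ i ∈ Finset.Ico U (U+t), 5 / 4 * statDist G u * 
          (2 * ∑ s ∈ Finset.range t, (lazyP G ^ s) u v) := by
        refine Finset.sum_le_sum fun i hi => ?_
        rw [← Finset.mul_sum]
        refine mul_le_mul_of_nonneg_left ?_ (by have := hpi u; positivity)
        exact aux_shift (fun s => (lazyP G ^ s) u v) (fun s => hnn s u v) U t i hi
    _ = _ := by
        rw [Finset.sum_const, Nat.card_Ico, nsmul_eq_mul]
        have : U + t - U = t := by omega
        rw [this]; ring

lemma aux_green {V : Type} [Fintype V] [Nontrivial V] (G : SimpleGraph V) (hG : G.Connected)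
    (t : ℕ) (ht : (relTime (lazyP G) : ℝ) ^ ((5 : ℝ) / 6) *
            Real.sqrt (Fintype.card V : ℝ) ≤ (t : ℝ)) :
    ∑ u, ∑ v, (1 / (G.degree u : ℝ)) * (1 / (G.degree v : ℝ)) *
      (statDist G u * ∑ s ∈ Finset.range t, (lazyP G ^ s) u v) ^ 2 ≤
      301 * (t:ℝ) ^ 2 / (2 * (numEdges G : ℝ)) ^ 2 := by
  obtain ⟨lam, f, ho, hc, he⟩ := aux_spectral G hG
  obtain ⟨δ, hδ, hδ1, hgap, hrel⟩ := aux_gap G hG lam f ho he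
  have hm := (aux_pi_pos G hG).1
  have hd := aux_deg_pos G hG
  let θ : V → ℝ := fun k => ∑ s ∈ Finset.range t, lam k ^ s
  have hg : ∀ u v, ∑ s ∈ Finset.range t, (lazyP G ^ s) u v = 
      (∑ k, θ k * f k u * f k v) * G.degree v := by
    intro u v
    simp only [aux_pow (lazyP G) (fun u => (G.degree u : ℝ)) lam f hc he]
    rw [Finset.sum_comm, Finset.sum_mul]
    refine Finset.sum_congr rfl fun k _ => ?_
    simp only [θ, Finset.sum_mul]
    exact Finset.sum_congr rfl fun s _ => by ring
  have h1 : ∑ u, ∑ v, (1 / (G.degree u : ℝ)) * (1 / (G.degree v : ℝ)) *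
      (statDist G u * ∑ s ∈ Finset.range t, (lazyP G ^ s) u v) ^ 2 = 
      (∑ k, θ k ^ 2) / (2 * (numEdges G : ℝ)) ^ 2 := by
    have e1 : ∀ u v, (1 / (G.degree u : ℝ)) * (1 / (G.degree v : ℝ)) *
      (statDist G u * ∑ s ∈ Finset.range t, (lazyP G ^ s) u v) ^ 2 = 
      (G.degree u : ℝ) / (2 * (numEdges G : ℝ)) ^ 2 *
        ((G.degree v : ℝ) * (∑ k, θ k * f k u * f k v) * (∑ k, θ k * f k u * f k v)) := by
      intro u v
      rw [hg]
      unfold statDist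
      have h1 := hd u
      have h2 := hd v
      have h3 : (numEdges G : ℝ) ≠ 0 := by intro h; rw [h] at hm; simp at hm
      field_simp
    simp only [e1, ← Finset.mul_sum]
    have e2 : ∀ u, ∑ v, ((G.degree v : ℝ) * (∑ k, θ k * f k u * f k v) *
        (∑ k, θ k * f k u * f k v)) = ∑ k, θ k * f k u * (θ k * f k u) := fun u =>
      aux_parseval (fun v => (G.degree v : ℝ)) f ho (fun k => θ k * f k u) (fun k => θ k * f k u)
    simp only [e2]
    simp only [Finset.mul_sum]
    rw [Finset.sum_comm, Finset.sum_div]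
    refine Finset.sum_congr rfl fun k _ => ?_
    have := ho k k
    rw [if_pos rfl] at this
    calc ∑ u, (G.degree u : ℝ) / (2 * (numEdges G : ℝ)) ^ 2 * (θ k * f k u * (θ k * f k u)) 
        = θ k ^ 2 / (2 * (numEdges G : ℝ)) ^ 2 * ∑ u, (G.degree u : ℝ) * f k u * f k u := by
          rw [Finset.mul_sum]; exact Finset.sum_congr rfl fun u _ => by ring
      _ = _ := by rw [this, mul_one]
  rw [h1]
  refine div_le_div_of_nonneg_right ?_ (by positivity)
  have hθ : ∀ k, θ k ^ 2 ≤ (if lam k = 1 then (t:ℝ) ^ 2 else 0) + 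
      (if lam k = 1 then 0 else 1 / (1 - lam k) ^ 2) := by
    intro k
    by_cases h : lam k = 1
    · simp [θ, h]
    · simp only [h, if_false, zero_add]
      have hb := aux_eig_bounds G hG _ (f k) (aux_f_ne _ f ho k) (he k)
      have hlt : 0 < 1 - lam k := lt_of_lt_of_le hδ (hgap k h)
      have hθ0 : 0 ≤ θ k := Finset.sum_nonneg fun s _ => pow_nonneg hb.1 s
      have hθ1 : θ k ≤ 1 / (1 - lam k) := by
        rw [le_div_iff₀ hlt]
        have := geom_sum_mul_neg (lam k) t
        simp only [θ]
        rw [this]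
        linarith [pow_nonneg hb.1 t]
      calc θ k ^ 2 ≤ (1 / (1 - lam k)) ^ 2 := by gcongr
        _ = _ := by rw [one_div_pow]
  have hone : ∑ k, (if lam k = 1 then (t:ℝ) ^ 2 else 0) ≤ (t:ℝ) ^ 2 := by
    obtain ⟨k0, hk0⟩ := aux_lam_one_exists G hG lam f hc he
    rw [Finset.sum_eq_single k0]
    · simp [hk0]
    · intro k _ hk
      have : lam k ≠ 1 := fun h => hk (aux_lam_one_unique G hG lam f ho he k k0 h hk0)
      simp [this]
    · simp
  set β : ℝ := δ ^ ((1:ℝ)/3) with hβd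
  have hβ : 0 < β := Real.rpow_pos_of_pos hδ _
  have hβ1 : β ≤ 1 := Real.rpow_le_one hδ.le hδ1 (by norm_num)
  have hβ3 : β ^ 3 = δ := by
    rw [hβd, ← Real.rpow_natCast, ← Real.rpow_mul hδ.le]; norm_num
  have hβ5 : 1 / β ^ 5 = (1 / δ) ^ ((5:ℝ)/3) := by
    rw [hβd, ← Real.rpow_natCast, ← Real.rpow_mul hδ.le, one_div, one_div, ← Real.inv_rpow hδ.le]
    norm_num
  have core := aux_core G hG lam f ho he β hβ hβ1 (by rw [hβ3]; exact hgap)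
  have hT : (Fintype.card V : ℝ) * (1 / β ^ 5) ≤ (t:ℝ) ^ 2 := by
    have hr0 : (0:ℝ) ≤ relTime (lazyP G) := Nat.cast_nonneg _
    have h2 : (1 / δ) ^ ((5:ℝ)/3) ≤ (relTime (lazyP G) : ℝ) ^ ((5:ℝ)/3) :=
      Real.rpow_le_rpow (by positivity) hrel (by norm_num)
    have h3 : ((relTime (lazyP G) : ℝ) ^ ((5 : ℝ) / 6) * Real.sqrt (Fintype.card V : ℝ)) ^ 2 =
        (relTime (lazyP G) : ℝ) ^ ((5:ℝ)/3) * Fintype.card V := by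
      rw [mul_pow, Real.sq_sqrt (Nat.cast_nonneg _), ← Real.rpow_natCast, ← Real.rpow_mul hr0]
      norm_num
    rw [hβ5]
    calc (Fintype.card V : ℝ) * (1 / δ) ^ ((5:ℝ)/3) 
        ≤ (Fintype.card V : ℝ) * (relTime (lazyP G) : ℝ) ^ ((5:ℝ)/3) := by gcongr
      _ = ((relTime (lazyP G) : ℝ) ^ ((5 : ℝ) / 6) * Real.sqrt (Fintype.card V : ℝ)) ^ 2 := by
          rw [h3]; ring
      _ ≤ (t:ℝ) ^ 2 := by gcongr
  have h4 : 300 * (Fintype.card V : ℝ) / β ^ 5 = 300 * ((Fintype.card V : ℝ) * (1 / β ^ 5)) := by ring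
  rw [h4] at core
  have h5 := Finset.sum_le_sum fun k (_ : k ∈ (Finset.univ : Finset V)) => hθ k
  rw [Finset.sum_add_distrib] at h5
  linarith

lemma aux_cheb {Ω : Type} [Fintype Ω] (w : Ω → ℝ) (hw0 : ∀ o, 0 ≤ w o) (hw : ∑ o, w o = 1)
    (J : Ω → Ω → ℝ) (t m B mu : ℝ) (hm : 0 < 2 * m) (ht : 0 < t)
    (hmu : ∑ p, ∑ q, w p * w q * J p q = mu)
    (h1 : t ^ 2 / (2 * m) ≤ mu) (h2 : mu ≤ 25 / 16 * (t ^ 2 / (2 * m)))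
    (h3 : ∑ p, ∑ q, w p * w q * J p q ^ 2 ≤ B * (t ^ 2 / (2 * m)) ^ 2)
    (K : ℕ) (hK : 1 ≤ K) :
    ∑ X : Fin K → Ω, ∑ Y : Fin K → Ω, (∏ k, w (X k)) * (∏ k, w (Y k)) *
      (if 1 / 2 < |t ^ 2 / ((2 / (K : ℝ)) * ∑ k, J (X k) (Y k)) / m - 1| then (1:ℝ) else 0) ≤
      9 * B / K := by
  set s := t ^ 2 / (2 * m) with hs
  have hm' : 0 < m := by linarith
  have hs0 : 0 < s := by positivity
  have hK0 : (0:ℝ) < K := by exact_mod_cast hK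
  let W : Ω × Ω → ℝ := fun o => w o.1 * w o.2
  let g : Ω × Ω → ℝ := fun o => J o.1 o.2 - mu
  have hW : ∑ o, W o = 1 := by
    simp only [W, Fintype.sum_prod_type, ← Finset.mul_sum, hw, mul_one]
  have hWJ : ∑ o, W o * J o.1 o.2 = mu := by
    simp only [W, Fintype.sum_prod_type, hmu]
  have hg : ∑ o, W o * g o = 0 := by
    simp only [g, mul_sub, Finset.sum_sub_distrib, ← Finset.sum_mul, hW, hWJ]; ring
  have hg2 : ∑ o, W o * g o ^ 2 ≤ B * s ^ 2 := by
    have e : ∀ o, W o * g o ^ 2 = W o * J o.1 o.2 ^ 2 - 2 * mu * (W o * J o.1 o.2) + mu ^ 2 * W o := by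
      intro o; simp only [g]; ring
    simp only [e, Finset.sum_add_distrib, Finset.sum_sub_distrib, ← Finset.mul_sum, hW, hWJ]
    have : ∑ o, W o * J o.1 o.2 ^ 2 ≤ B * s ^ 2 := by
      simpa only [W, Fintype.sum_prod_type] using h3
    nlinarith [sq_nonneg mu]
  have hvar := aux_prod_var W g hW hg K
  have key : ∀ X Y : Fin K → Ω,
      (if 1 / 2 < |t ^ 2 / ((2 / (K : ℝ)) * ∑ k, J (X k) (Y k)) / m - 1| then (1:ℝ) else 0) ≤
      9 / ((K:ℝ) * s) ^ 2 * (∑ k, (J (X k) (Y k) - mu)) ^ 2 := by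
    intro X Y
    set S := ∑ k, J (X k) (Y k) with hS
    have hsum : ∑ k, (J (X k) (Y k) - mu) = S - K * mu := by
      rw [Finset.sum_sub_distrib]; simp [hS]
    rw [hsum]
    split_ifs with hI
    · by_contra hc
      push Not at hc
      have hlt : (S - K * mu) ^ 2 < (K * s / 3) ^ 2 := by
        rw [div_mul_eq_mul_div, div_lt_one (by positivity)] at hc
        nlinarith
      have hab := abs_lt_of_sq_lt_sq hlt (by positivity)
      rw [abs_lt] at hab
      have hKs : 0 < K * s := by positivity
      have hl : 2 / 3 * (K * s) < S := by nlinarith [hab.1]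
      have hu : S < 91 / 48 * (K * s) := by nlinarith [hab.2]
      have hSpos : 0 < S := by linarith
      have e : t ^ 2 / ((2 / (K : ℝ)) * S) / m = K * s / S := by
        rw [hs]; field_simp
      rw [e] at hI
      have h4 : K * s / S < 3 / 2 := by rw [div_lt_iff₀ hSpos]; linarith
      have h5 : 1 / 2 < K * s / S := by rw [lt_div_iff₀ hSpos]; linarith
      have : |K * s / S - 1| ≤ 1 / 2 := by rw [abs_le]; constructor <;> linarith
      linarith
    · positivity
  calc _ ≤ ∑ X : Fin K → Ω, ∑ Y : Fin K → Ω, (∏ k, w (X k)) * (∏ k, w (Y k)) *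
        (9 / ((K:ℝ) * s) ^ 2 * (∑ k, (J (X k) (Y k) - mu)) ^ 2) := by
        refine Finset.sum_le_sum fun X _ => Finset.sum_le_sum fun Y _ => ?_
        exact mul_le_mul_of_nonneg_left (key X Y) (mul_nonneg
          (Finset.prod_nonneg fun k _ => hw0 _) (Finset.prod_nonneg fun k _ => hw0 _))
    _ = 9 / ((K:ℝ) * s) ^ 2 * ∑ ω : Fin K → Ω × Ω, (∏ k, W (ω k)) * (∑ k, g (ω k)) ^ 2 := by
        rw [← (Equiv.arrowProdEquivProdArrow (Fin K) (fun _ => Ω) (fun _ => Ω)).symm.sum_comp,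
          Fintype.sum_prod_type, Finset.mul_sum]
        refine Finset.sum_congr rfl fun X _ => ?_
        rw [Finset.mul_sum]
        refine Finset.sum_congr rfl fun Y _ => ?_
        simp only [W, g, Equiv.arrowProdEquivProdArrow_symm_apply, Finset.prod_mul_distrib]
        ring
    _ ≤ 9 / ((K:ℝ) * s) ^ 2 * (K * (B * s ^ 2)) := by
        rw [hvar]; gcongr
    _ = 9 * B / K := by field_simp

lemma aux_final {V : Type} [Fintype V] [Nontrivial V] (G : SimpleGraph V) (hG : G.Connected)
    (x : V) (K t : ℕ) (hK : 1 ≤ K) (ht : (relTime (lazyP G) : ℝ) ^ ((5 : ℝ) / 6) *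
            Real.sqrt (Fintype.card V : ℝ) ≤ (t : ℝ)) :
    EK (lazyP G) x (unifTime G + t) K (fun X Y =>
              if 1 / 2 <
                  |(t : ℝ) ^ 2 /
                      ((2 / (K : ℝ)) *
                        ∑ k, wInterIco G (unifTime G) (unifTime G + t) (X k) (Y k)) /
                      (numEdges G : ℝ) - 1|
              then 1 else 0) ≤ 20000 / (K : ℝ) := by
  have hP := aux_P_row G hG
  obtain ⟨hm, hpi⟩ := aux_pi_pos G hG
  have hd := aux_deg_pos G hG
  have hnn := fun i => aux_pow_nonneg (lazyP G) (aux_P_nonneg G) i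
  obtain ⟨lam, f, ho, hc, he⟩ := aux_spectral G hG
  have ht0 : (0:ℝ) < t := by
    obtain ⟨δ, hδ, hδ1, hgap, hrel⟩ := aux_gap G hG lam f ho he
    refine lt_of_lt_of_le ?_ ht
    have h1 : (0:ℝ) < relTime (lazyP G) := lt_of_lt_of_le (by positivity) hrel
    have h2 : (0:ℝ) < Fintype.card V := by exact_mod_cast Fintype.card_pos
    positivity
  have ht1 : 0 < t := by exact_mod_cast ht0
  have hrev : ∀ (i : ℕ) (u v : V),
      statDist G u * (lazyP G ^ i) u v = statDist G v * (lazyP G ^ i) v u := by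
    intro i u v
    rw [aux_pow (lazyP G) (fun u => (G.degree u : ℝ)) lam f hc he,
      aux_pow (lazyP G) (fun u => (G.degree u : ℝ)) lam f hc he, Finset.mul_sum, Finset.mul_sum]
    refine Finset.sum_congr rfl fun k _ => ?_
    unfold statDist; ring
  have hu : ∀ i, unifTime G ≤ i → ∀ u, (lazyP G ^ i) x u ≤ 5 / 4 * statDist G u := by
    intro i hi u
    have h := (abs_le.1 (aux_unif G hG i hi x u)).2
    have h' : (lazyP G ^ i) x u / statDist G u ≤ 5 / 4 := by linarith
    rwa [div_le_iff₀ (hpi u)] at h'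
  have hgreen := aux_green G hG t ht
  have hmom2 := fun u v => aux_moment2 G hG x t u v hrev hu
  set U := unifTime G with hU
  have hmom1 := aux_moment1 (lazyP G) hP x U t
  set w : (Fin (U + t) → V) → ℝ := pathWeight (lazyP G) x (U + t) with hwd
  set Lo : (Fin (U + t) → V) → V → ℝ := fun p u =>
    ∑ i ∈ Finset.Ico U (U+t), if traj p i = u then (1:ℝ) else 0 with hLo
  have hLo0 : ∀ p u, 0 ≤ Lo p u := fun p u => Finset.sum_nonneg fun i _ => by
    split_ifs <;> norm_num
  have hw0 : ∀ p, 0 ≤ w p := fun p => aux_nonneg (lazyP G) (aux_P_nonneg G) (U + t) x p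
  have hw : ∑ p, w p = 1 := by
    obtain ⟨T, hT⟩ : ∃ T, U + t = T + 1 := ⟨U + t - 1, by omega⟩
    have := aux_mass (lazyP G) hP T x
    rw [hwd]
    clear_value U
    clear * - this hT
    rw [hT]; exact this
  have hJ : ∀ p q : Fin (U + t) → V, wInterIco G U (U + t) p q =
      ∑ u, (1 / (G.degree u : ℝ)) * (Lo p u * Lo q u) := fun p q => aux_inter G U (U + t) p q
  let a : V → ℝ := fun u => ∑ i ∈ Finset.Ico U (U+t), (lazyP G ^ i) x u
  have hmu : ∑ p, ∑ q, w p * w q * wInterIco G U (U + t) p q =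
      ∑ u, (1 / (G.degree u : ℝ)) * a u ^ 2 := by
    simp only [hJ]
    rw [aux_E1 w Lo (fun u => 1 / (G.degree u : ℝ))]
    refine Finset.sum_congr rfl fun u _ => ?_
    rw [hmom1 u]
  have hcard : U + t - U = t := by omega
  have ha : ∑ u, a u = t := by
    simp only [a]
    rw [Finset.sum_comm]
    simp only [aux_pow_row (lazyP G) hP, Finset.sum_const, Nat.card_Ico, hcard, nsmul_eq_mul, mul_one]
  have ha0 : ∀ u, 0 ≤ a u := fun u => Finset.sum_nonneg fun i _ => hnn i x u
  have ha1 : ∀ u, a u ≤ t * (5 / 4 * statDist G u) := by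
    intro u
    have : a u ≤ ∑ i ∈ Finset.Ico U (U+t), 5 / 4 * statDist G u :=
      Finset.sum_le_sum fun i hi => hu i (Finset.mem_Ico.1 hi).1 u
    rwa [Finset.sum_const, Nat.card_Ico, hcard, nsmul_eq_mul] at this
  have hlow : (t:ℝ) ^ 2 / (2 * numEdges G) ≤ ∑ u, (1 / (G.degree u : ℝ)) * a u ^ 2 := by
    have := Finset.sum_sq_le_sum_mul_sum_of_sq_eq_mul Finset.univ (r := a)
      (f := fun u => (1 / (G.degree u : ℝ)) * a u ^ 2) (g := fun u => (G.degree u : ℝ))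
      (fun u _ => by have := hd u; positivity) (fun u _ => (hd u).le)
      (fun u _ => by have := hd u; field_simp)
    rw [ha, aux_deg_total] at this
    rwa [div_le_iff₀ hm]
  have hup : ∑ u, (1 / (G.degree u : ℝ)) * a u ^ 2 ≤ 25 / 16 * ((t:ℝ) ^ 2 / (2 * numEdges G)) := by
    calc _ ≤ ∑ u, (25 / 16 * (t:ℝ) ^ 2 / (2 * numEdges G) ^ 2) * (G.degree u : ℝ) := by
          refine Finset.sum_le_sum fun u _ => ?_
          have h1 := hd u
          calc _ ≤ (1 / (G.degree u : ℝ)) * (t * (5 / 4 * statDist G u)) ^ 2 := by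
                have := ha0 u
                have := ha1 u
                gcongr
            _ = _ := by
                unfold statDist; field_simp; norm_num
      _ = _ := by
          rw [← Finset.mul_sum, aux_deg_total]; field_simp
  have hsec : ∑ p, ∑ q, w p * w q * wInterIco G U (U + t) p q ^ 2 ≤
      (25 / 4 * 301) * ((t:ℝ) ^ 2 / (2 * numEdges G)) ^ 2 := by
    simp only [hJ]
    rw [aux_E2 w Lo (fun u => 1 / (G.degree u : ℝ))]
    calc _ ≤ ∑ u, ∑ v, (25 / 4 * (t:ℝ) ^ 2) * ((1 / (G.degree u : ℝ)) * (1 / (G.degree v : ℝ)) *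
          (statDist G u * ∑ s ∈ Finset.range t, (lazyP G ^ s) u v) ^ 2) := by
          refine Finset.sum_le_sum fun u _ => Finset.sum_le_sum fun v _ => ?_
          have h1 := hd u
          have h2 := hd v
          have h3 : 0 ≤ ∑ p, w p * (Lo p u * Lo p v) := Finset.sum_nonneg fun p _ =>
            mul_nonneg (hw0 p) (mul_nonneg (hLo0 p u) (hLo0 p v))
          calc _ ≤ (1 / (G.degree u : ℝ)) * (1 / (G.degree v : ℝ)) *
                (5 / 2 * t * (statDist G u * ∑ s ∈ Finset.range t, (lazyP G ^ s) u v)) ^ 2 :=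
                mul_le_mul_of_nonneg_left (pow_le_pow_left₀ h3 (hmom2 u v) 2) (by positivity)
            _ = _ := by ring
      _ = (25 / 4 * (t:ℝ) ^ 2) * ∑ u, ∑ v, (1 / (G.degree u : ℝ)) * (1 / (G.degree v : ℝ)) *
          (statDist G u * ∑ s ∈ Finset.range t, (lazyP G ^ s) u v) ^ 2 := by
          rw [Finset.mul_sum]
          exact Finset.sum_congr rfl fun u _ => by rw [Finset.mul_sum]
      _ ≤ (25 / 4 * (t:ℝ) ^ 2) * (301 * (t:ℝ) ^ 2 / (2 * (numEdges G : ℝ)) ^ 2) :=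
          mul_le_mul_of_nonneg_left hgreen (by positivity)
      _ = _ := by rw [div_pow]; ring
  have := aux_cheb w hw0 hw (fun p q => wInterIco G U (U + t) p q) t (numEdges G)
    (25 / 4 * 301) _ hm ht0 hmu hlow hup hsec K hK
  unfold EK
  refine this.trans ?_
  have hK0 : (0:ℝ) < K := by exact_mod_cast hK
  gcongr
  norm_num

/-- There are universal constants `c₀, C > 0` such that for every finite
connected graph `G` with `n` vertices, `m` edges and relaxation time `t_rel`, every vertex
`x`, every `K ≥ 1` and every `t ≥ c₀ t_rel^{5/6} √n`, the estimator
`m̃_t = t² / ((2/K) ∑_k 𝓙_t^{(k)})` built from `K` independent pairs of lazy random walks of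
length `t_unif + t` started at `x` (intersections counted over the window
`[t_unif, t_unif + t - 1]`) satisfies `P_x(|m̃_t/m - 1| > 1/2) ≤ C/K`. -/
theorem edge_estimator_from_mixing : ∃ c₀ C : ℝ, 0 < c₀ ∧ 0 < C ∧
    ∀ (V : Type) [Fintype V] [Nontrivial V] (G : SimpleGraph V), G.Connected →
      ∀ (x : V) (K t : ℕ), 1 ≤ K →
        c₀ * (relTime (lazyP G) : ℝ) ^ ((5 : ℝ) / 6) *
            Real.sqrt (Fintype.card V : ℝ) ≤ (t : ℝ) →
          EK (lazyP G) x (unifTime G + t) K (fun X Y =>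
              if 1 / 2 <
                  |(t : ℝ) ^ 2 /
                      ((2 / (K : ℝ)) *
                        ∑ k, wInterIco G (unifTime G) (unifTime G + t) (X k) (Y k)) /
                      (numEdges G : ℝ) - 1|
              then 1 else 0) ≤ C / (K : ℝ) := by
  refine ⟨1, 20000, by norm_num, by norm_num, ?_⟩
  intro V _ _ G hG x K t hK ht
  rw [one_mul] at ht
  exact aux_final G hG x K t hK ht
end

section
/- There is a universal constant C > 0 such that for every finite connected graph G=(V,E), every vertex x and every t ≥ 1, if X,Y are two independent lazy random walks started at x, then Var_x(ℒ_t^{(X,Y)}) ≤ C·E_x[ℒ_t^{(X,Y)}]·max_{u∈V} E_u[𝓘_t], where ℒ_t^{(X,Y)} is the weighted number of intersections of X and Y between times t and 2t−1 and 𝓘_t is the weighted number of intersections of two independent lazy random walks up to time t−1. -/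
open Finset
open scoped Classical BigOperators

section aux
variable {V : Type} [Fintype V] [Nonempty V]

/-- expectation for one walk -/
noncomputable def Eone (P : Matrix V V ℝ) (x : V) (T : ℕ) (F : (Fin T → V) → ℝ) : ℝ :=
  ∑ p : Fin T → V, pathWeight P x T p * F p

/-- occupation counts -/
noncomputable def occ (a b : ℕ) {T : ℕ} (p : Fin T → V) (u : V) : ℝ :=
  ∑ i ∈ Finset.Ico a b, if traj p i = u then (1 : ℝ) else 0

lemma traj_cons_zero {n : ℕ} (y : V) (p : Fin n → V) :
    traj (Fin.cons y p : Fin (n+1) → V) 0 = y := by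
  simp [traj]

lemma traj_cons_succ {n : ℕ} (y : V) (p : Fin n → V) (i : ℕ) :
    traj (Fin.cons y p : Fin (n+1) → V) (i+1) = traj p i := by
  unfold traj
  by_cases h : i < n
  · have h' : i + 1 < n + 1 := by omega
    rw [dif_pos h, dif_pos h']
    exact Fin.cons_succ (α := fun _ => V) y p ⟨i, h⟩
  · have h' : ¬ (i + 1 < n + 1) := by omega
    rw [dif_neg h, dif_neg h']

lemma pw_cons (P : Matrix V V ℝ) (x y : V) (n : ℕ) (p : Fin (n+1) → V) :
    pathWeight P x (n+2) (Fin.cons y p : Fin (n+2) → V) =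
      if y = x then ∑ z, P x z * pathWeight P z (n+1) p else 0 := by
  unfold pathWeight
  rw [traj_cons_zero]
  by_cases h : y = x
  · subst h
    simp only [if_true, one_mul]
    rw [show n + 2 - 1 = n + 1 from rfl, Finset.prod_range_succ', mul_comm]
    simp only [traj_cons_zero, traj_cons_succ, show n + 1 - 1 = n from rfl]
    simp [traj_cons_succ, traj_cons_zero]
  · simp [h]

lemma Eone_step (P : Matrix V V ℝ) (x : V) (n : ℕ) (F : (Fin (n+2) → V) → ℝ) :
    Eone P x (n+2) F = ∑ z, P x z * Eone P z (n+1) (fun p => F (Fin.cons x p)) := by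
  unfold Eone
  rw [← (Fin.consEquiv (fun _ : Fin (n+2) => V)).sum_comp, Fintype.sum_prod_type]
  have : ∀ (y : V) (p : Fin (n+1) → V),
      (Fin.consEquiv (fun _ : Fin (n+2) => V)) (y, p) = Fin.cons y p := fun _ _ => rfl
  simp only [this, pw_cons]
  rw [Finset.sum_eq_single x]
  · simp only [if_true, Finset.sum_mul, Finset.mul_sum]
    rw [Finset.sum_comm]
    simp only [mul_assoc]
  · intro y _ hy
    simp [hy]
  · simp

lemma Eone_one (P : Matrix V V ℝ) (x : V) (F : (Fin 1 → V) → ℝ) :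
    Eone P x 1 F = F (fun _ => x) := by
  unfold Eone
  rw [Finset.sum_eq_single (fun _ => x)]
  · simp [pathWeight, traj]
  · intro p _ hp
    have : p 0 ≠ x := fun h => hp (by ext i; rw [Subsingleton.elim i 0, h])
    simp [pathWeight, traj, this]
  · simp

lemma Eone_const (P : Matrix V V ℝ) (hP : ∀ x, ∑ y, P x y = 1) (c : ℝ) (n : ℕ) :
    ∀ x : V, Eone P x (n+1) (fun _ => c) = c := by
  induction n with
  | zero => intro x; rw [Eone_one]
  | succ n ih =>
    intro x
    rw [Eone_step]
    simp only [ih, ← Finset.sum_mul, hP, one_mul]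

lemma Eone_marg (P : Matrix V V ℝ) (hP : ∀ x, ∑ y, P x y = 1) (u : V) (n : ℕ) :
    ∀ (x : V) (i : ℕ), i < n + 1 →
      Eone P x (n+1) (fun p => if traj p i = u then 1 else 0) = (P ^ i) x u := by
  induction n with
  | zero =>
    intro x i hi
    obtain rfl : i = 0 := by omega
    rw [Eone_one]
    simp [traj, Matrix.one_apply]
  | succ n ih =>
    intro x i hi
    rw [Eone_step]
    cases i with
    | zero =>
      simp only [traj_cons_zero, Eone_const P hP, ← Finset.sum_mul, hP, one_mul]
      simp [Matrix.one_apply]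
    | succ i =>
      simp only [traj_cons_succ]
      rw [pow_succ', Matrix.mul_apply]
      exact Finset.sum_congr rfl fun z _ => by rw [ih z i (by omega)]

lemma Eone_marg2 (P : Matrix V V ℝ) (hP : ∀ x, ∑ y, P x y = 1) (u v : V) (n : ℕ) :
    ∀ (x : V) (i k : ℕ), i ≤ k → k < n + 1 →
      Eone P x (n+1) (fun p => (if traj p i = u then 1 else 0) * (if traj p k = v then 1 else 0))
        = (P ^ i) x u * (P ^ (k - i)) u v := by
  induction n with
  | zero =>
    intro x i k hik hk
    obtain rfl : k = 0 := by omega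
    obtain rfl : i = 0 := by omega
    rw [Eone_one]
    by_cases h : x = u
    · subst h; simp [traj, Matrix.one_apply]
    · simp [traj, Matrix.one_apply, h]
  | succ n ih =>
    intro x i k hik hk
    cases i with
    | zero =>
      by_cases h : x = u
      · subst h
        have := Eone_marg P hP v (n+1) x k hk
        rw [Eone_step] at this ⊢
        simp only [traj_cons_zero, if_true, one_mul]
        rw [this]; simp
      · rw [Eone_step]
        simp [traj_cons_zero, h, Matrix.one_apply, Eone_const P hP]
    | succ i =>
      obtain ⟨k, rfl⟩ : ∃ k', k = k' + 1 := ⟨k - 1, by omega⟩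
      rw [Eone_step]
      simp only [traj_cons_succ]
      rw [pow_succ', Matrix.mul_apply, Finset.sum_mul]
      refine Finset.sum_congr rfl fun z _ => ?_
      rw [ih z i k (by omega) (by omega), mul_assoc, Nat.add_sub_add_right]

lemma Eone_sum {ι : Type*} (s : Finset ι) (P : Matrix V V ℝ) (x : V) (T : ℕ)
    (F : ι → (Fin T → V) → ℝ) :
    Eone P x T (fun p => ∑ i ∈ s, F i p) = ∑ i ∈ s, Eone P x T (F i) := by
  unfold Eone
  simp only [Finset.mul_sum]
  rw [Finset.sum_comm]

lemma Eone_occ (P : Matrix V V ℝ) (hP : ∀ x, ∑ y, P x y = 1) (x u : V) (a b : ℕ) (T : ℕ)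
    (hb : b ≤ T) :
    Eone P x T (fun p => occ a b p u) = ∑ i ∈ Finset.Ico a b, (P ^ i) x u := by
  unfold occ
  rw [Eone_sum]
  refine Finset.sum_congr rfl fun i hi => ?_
  rw [Finset.mem_Ico] at hi
  obtain ⟨n, rfl⟩ : ∃ n, T = n + 1 := ⟨T - 1, by omega⟩
  exact Eone_marg P hP u n x i (by omega)

lemma sum_shift_le (P : Matrix V V ℝ) (h0 : ∀ (i : ℕ) (x y : V), 0 ≤ (P ^ i) x y)
    (u v : V) (t i : ℕ) (hi : t ≤ i) :
    ∑ k ∈ Finset.Ico t (2*t), (if i ≤ k then (P ^ (k - i)) u v else 0) ≤ green P t u v := by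
  unfold green
  rw [← Finset.sum_filter]
  have : ∑ k ∈ (Finset.Ico t (2*t)).filter (fun k => i ≤ k), (P ^ (k - i)) u v =
      ∑ j ∈ ((Finset.Ico t (2*t)).filter (fun k => i ≤ k)).image (fun k => k - i),
        (P ^ j) u v := by
    rw [Finset.sum_image]
    intro a ha b hb hab
    simp only [Finset.coe_filter, Finset.mem_Ico, Set.mem_setOf_eq] at ha hb hab
    omega
  rw [this]
  apply Finset.sum_le_sum_of_subset_of_nonneg
  · intro j hj
    simp only [Finset.mem_image, Finset.mem_filter, Finset.mem_Ico] at hj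
    obtain ⟨k, hk, rfl⟩ := hj
    rw [Finset.mem_range]; omega
  · intros; exact h0 _ _ _

lemma Eone_occ2 (P : Matrix V V ℝ) (hP : ∀ x, ∑ y, P x y = 1)
    (h0 : ∀ (i : ℕ) (x y : V), 0 ≤ (P ^ i) x y) (x u v : V) (t : ℕ) :
    Eone P x (2*t) (fun p => occ t (2*t) p u * occ t (2*t) p v) ≤
      (∑ i ∈ Finset.Ico t (2*t), (P ^ i) x u) * green P t u v +
      (∑ i ∈ Finset.Ico t (2*t), (P ^ i) x v) * green P t v u := by
  unfold occ
  simp only [Finset.sum_mul_sum]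
  rw [Eone_sum]
  simp only [Eone_sum]
  have key : ∀ i ∈ Finset.Ico t (2*t), ∀ k ∈ Finset.Ico t (2*t),
      Eone P x (2*t) (fun p => (if traj p i = u then (1:ℝ) else 0) *
        (if traj p k = v then 1 else 0)) ≤
      (P ^ i) x u * (if i ≤ k then (P ^ (k - i)) u v else 0) +
      (P ^ k) x v * (if k ≤ i then (P ^ (i - k)) v u else 0) := by
    intro i hi k hk
    rw [Finset.mem_Ico] at hi hk
    obtain ⟨n, hn⟩ : ∃ n, 2 * t = n + 1 := ⟨2 * t - 1, by omega⟩
    rw [hn] at hi hk ⊢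
    rcases le_total i k with h | h
    · rw [Eone_marg2 P hP u v n x i k h hk.2, if_pos h]
      have : 0 ≤ (P ^ k) x v * (if k ≤ i then (P ^ (i - k)) v u else 0) := by
        split_ifs
        · exact mul_nonneg (h0 _ _ _) (h0 _ _ _)
        · simp
      linarith
    · have e := Eone_marg2 P hP v u n x k i h hi.2
      simp only [mul_comm (ite (traj _ k = v) (1:ℝ) 0)] at e
      rw [e, if_pos h]
      have : 0 ≤ (P ^ i) x u * (if i ≤ k then (P ^ (k - i)) u v else 0) := by
        split_ifs
        · exact mul_nonneg (h0 _ _ _) (h0 _ _ _)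
        · simp
      linarith
  refine (Finset.sum_le_sum fun i hi => Finset.sum_le_sum fun k hk => key i hi k hk).trans ?_
  simp only [Finset.sum_add_distrib]
  apply add_le_add
  · rw [Finset.sum_mul]
    refine Finset.sum_le_sum fun i hi => ?_
    rw [← Finset.mul_sum]
    exact mul_le_mul_of_nonneg_left
      (sum_shift_le P h0 u v t i (Finset.mem_Ico.1 hi).1) (h0 _ _ _)
  · rw [Finset.sum_comm, Finset.sum_mul]
    refine Finset.sum_le_sum fun i hi => ?_
    rw [← Finset.mul_sum]
    exact mul_le_mul_of_nonneg_left
      (sum_shift_le P h0 v u t i (Finset.mem_Ico.1 hi).1) (h0 _ _ _)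

lemma wInter_eq (G : SimpleGraph V) (a b : ℕ) {T : ℕ} (p q : Fin T → V) :
    wInterIco G a b p q = ∑ u, occ a b p u * occ a b q u * (1 / (G.degree u : ℝ)) := by
  unfold wInterIco occ
  simp only [Finset.sum_mul, Finset.mul_sum]
  rw [Finset.sum_comm]
  symm
  rw [Finset.sum_comm]
  refine Finset.sum_congr rfl fun j _ => ?_
  rw [Finset.sum_comm]
  refine Finset.sum_congr rfl fun i _ => ?_
  rw [Finset.sum_eq_single (traj p i)]
  · by_cases h : traj p i = traj q j
    · simp [h]
    · simp [h, Ne.symm h]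
  · intro u _ hu
    simp [Ne.symm hu]
  · simp

lemma E2_sum {ι : Type*} (s : Finset ι) (P : Matrix V V ℝ) (x : V) (T : ℕ)
    (A : ι → (Fin T → V) → ℝ) (c : ι → ℝ) :
    E2 P x x T (fun p q => ∑ i ∈ s, A i p * A i q * c i) =
      ∑ i ∈ s, (Eone P x T (A i)) ^ 2 * c i := by
  unfold E2 Eone
  have h1 : ∀ p : Fin T → V, ∑ q : Fin T → V, pathWeight P x T p * pathWeight P x T q *
      (∑ i ∈ s, A i p * A i q * c i) = ∑ i ∈ s, ∑ q : Fin T → V,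
        pathWeight P x T p * A i p * (pathWeight P x T q * A i q) * c i := by
    intro p
    rw [Finset.sum_comm]
    refine Finset.sum_congr rfl fun q _ => ?_
    rw [Finset.mul_sum]
    exact Finset.sum_congr rfl fun i _ => by ring
  simp only [h1]
  rw [Finset.sum_comm]
  refine Finset.sum_congr rfl fun i _ => ?_
  rw [sq, Finset.sum_mul_sum, Finset.sum_mul]
  exact Finset.sum_congr rfl fun p _ => by rw [Finset.sum_mul]

lemma E2_wInter (G : SimpleGraph V) (P : Matrix V V ℝ) (hP : ∀ x, ∑ y, P x y = 1) (x : V)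
    (a b T : ℕ) (hb : b ≤ T) :
    E2 P x x T (fun p q => wInterIco G a b p q) =
      ∑ u, (∑ i ∈ Finset.Ico a b, (P ^ i) x u) ^ 2 * (1 / (G.degree u : ℝ)) := by
  simp only [wInter_eq]
  rw [E2_sum Finset.univ P x T (fun u p => occ a b p u)]
  simp only [Eone_occ P hP x _ a b T hb]

lemma E2_wInter_sq (G : SimpleGraph V) (P : Matrix V V ℝ) (x : V) (a b T : ℕ) :
    E2 P x x T (fun p q => (wInterIco G a b p q) ^ 2) =
      ∑ w : V × V, (Eone P x T (fun p => occ a b p w.1 * occ a b p w.2)) ^ 2 *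
        (1 / (G.degree w.1 : ℝ) * (1 / (G.degree w.2 : ℝ))) := by
  rw [← E2_sum Finset.univ P x T (fun (w : V × V) p => occ a b p w.1 * occ a b p w.2)]
  congr 1
  funext p q
  rw [wInter_eq, sq, Finset.sum_mul_sum, Fintype.sum_prod_type]
  refine Finset.sum_congr rfl fun u _ => Finset.sum_congr rfl fun v _ => ?_
  ring

lemma pathWeight_nonneg (P : Matrix V V ℝ) (h0 : ∀ x y : V, 0 ≤ P x y) (x : V) (T : ℕ)
    (p : Fin T → V) : 0 ≤ pathWeight P x T p := by
  unfold pathWeight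
  refine mul_nonneg (by split_ifs <;> norm_num) (Finset.prod_nonneg fun i _ => h0 _ _)

lemma occ_nonneg (a b : ℕ) {T : ℕ} (p : Fin T → V) (u : V) : 0 ≤ occ a b p u :=
  Finset.sum_nonneg fun i _ => by split_ifs <;> norm_num

lemma lazyP_nonneg (G : SimpleGraph V) (x y : V) : 0 ≤ lazyP G x y := by
  unfold lazyP
  split_ifs <;> positivity

lemma pow_entry_nonneg (P : Matrix V V ℝ) (h0 : ∀ x y : V, 0 ≤ P x y) (i : ℕ) :
    ∀ x y : V, 0 ≤ (P ^ i) x y := by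
  induction i with
  | zero => intro x y; rw [pow_zero, Matrix.one_apply]; split_ifs <;> norm_num
  | succ i ih =>
    intro x y
    rw [pow_succ, Matrix.mul_apply]
    exact Finset.sum_nonneg fun z _ => mul_nonneg (ih _ _) (h0 _ _)

lemma lazyP_row (G : SimpleGraph V) (x : V) (hx : 0 < G.degree x) :
    ∑ y, lazyP G x y = 1 := by
  have h : ∀ y, lazyP G x y = (if x = y then 1 / 2 else 0) +
      (if y ∈ G.neighborFinset x then 1 / (2 * (G.degree x : ℝ)) else 0) := by
    intro y
    unfold lazyP
    by_cases h : x = y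
    · subst h; simp
    · simp [h]
  have hd : (G.degree x : ℝ) ≠ 0 := by positivity
  simp only [h, Finset.sum_add_distrib, Finset.sum_ite_eq, Finset.mem_univ, if_true]
  rw [← Finset.sum_filter, Finset.sum_const]
  rw [show Finset.univ.filter (fun y => y ∈ G.neighborFinset x) = G.neighborFinset x by
    ext; simp]
  rw [SimpleGraph.card_neighborFinset_eq_degree, nsmul_eq_mul]
  field_simp
  norm_num

lemma second_moment (G : SimpleGraph V) (hd : ∀ x, 0 < G.degree x) (x : V) (t : ℕ) :
    ELsq G x t ≤ 4 * EL G x t * ⨆ u : V, EI G u t := by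
  have hP : ∀ x, ∑ y, lazyP G x y = 1 := fun x => lazyP_row G x (hd x)
  have h0 := pow_entry_nonneg (lazyP G) (lazyP_nonneg G)
  have hEI : ∀ u, EI G u t = ∑ v, (green (lazyP G) t u v) ^ 2 * (1 / (G.degree v : ℝ)) := by
    intro u
    unfold EI EIxy wInter
    rw [E2_wInter G _ hP u 0 t t le_rfl]
    simp only [green, Finset.range_eq_Ico]
  unfold ELsq EL
  rw [E2_wInter_sq, E2_wInter G _ hP x t (2*t) (2*t) le_rfl]
  set g := green (lazyP G) t
  set H : V → ℝ := fun u => ∑ i ∈ Finset.Ico t (2*t), (lazyP G ^ i) x u with hH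
  set M := ⨆ u : V, EI G u t
  have hM : ∀ u, EI G u t ≤ M := fun u => le_ciSup (f := fun u => EI G u t) (Set.finite_range _).bddAbove u
  have hb : ∀ w : V × V,
      (Eone (lazyP G) x (2*t) (fun p => occ t (2*t) p w.1 * occ t (2*t) p w.2)) ^ 2 *
        (1 / (G.degree w.1 : ℝ) * (1 / (G.degree w.2 : ℝ))) ≤
      (2 * (H w.1 ^ 2 * g w.1 w.2 ^ 2) + 2 * (H w.2 ^ 2 * g w.2 w.1 ^ 2)) *
        (1 / (G.degree w.1 : ℝ) * (1 / (G.degree w.2 : ℝ))) := by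
    rintro ⟨u, v⟩
    refine mul_le_mul_of_nonneg_right ?_ (by positivity)
    have h1 := Eone_occ2 (lazyP G) hP h0 x u v t
    have h2 : 0 ≤ Eone (lazyP G) x (2*t) (fun p => occ t (2*t) p u * occ t (2*t) p v) :=
      Finset.sum_nonneg fun p _ => mul_nonneg (pathWeight_nonneg _ (lazyP_nonneg G) _ _ _)
        (mul_nonneg (occ_nonneg _ _ _ _) (occ_nonneg _ _ _ _))
    have h3 := pow_le_pow_left₀ h2 h1 2
    refine h3.trans ?_
    show (H u * g u v + H v * g v u) ^ 2 ≤ _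
    nlinarith [sq_nonneg (H u * g u v - H v * g v u)]
  refine (Finset.sum_le_sum fun w _ => hb w).trans ?_
  have hS : ∑ u, ∑ v, H u ^ 2 * g u v ^ 2 * (1 / (G.degree u : ℝ) * (1 / (G.degree v : ℝ)))
      ≤ (∑ u, H u ^ 2 * (1 / (G.degree u : ℝ))) * M := by
    rw [Finset.sum_mul]
    refine Finset.sum_le_sum fun u _ => ?_
    have : ∑ v, H u ^ 2 * g u v ^ 2 * (1 / (G.degree u : ℝ) * (1 / (G.degree v : ℝ))) =
        H u ^ 2 * (1 / (G.degree u : ℝ)) * EI G u t := by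
      rw [hEI, Finset.mul_sum]
      exact Finset.sum_congr rfl fun v _ => by ring
    rw [this]
    exact mul_le_mul_of_nonneg_left (hM u) (by positivity)
  have e : ∑ w : V × V, (2 * (H w.1 ^ 2 * g w.1 w.2 ^ 2) + 2 * (H w.2 ^ 2 * g w.2 w.1 ^ 2)) *
        (1 / (G.degree w.1 : ℝ) * (1 / (G.degree w.2 : ℝ))) =
      4 * ∑ u, ∑ v, H u ^ 2 * g u v ^ 2 * (1 / (G.degree u : ℝ) * (1 / (G.degree v : ℝ))) := by
    have e1 : ∑ u, ∑ v, H v ^ 2 * g v u ^ 2 * (1 / (G.degree u : ℝ) * (1 / (G.degree v : ℝ))) =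
        ∑ u, ∑ v, H u ^ 2 * g u v ^ 2 * (1 / (G.degree u : ℝ) * (1 / (G.degree v : ℝ))) := by
      rw [Finset.sum_comm]
      refine Finset.sum_congr rfl fun u _ => Finset.sum_congr rfl fun v _ => ?_
      ring
    rw [Fintype.sum_prod_type]
    simp only [add_mul, Finset.sum_add_distrib, mul_assoc (2:ℝ), ← Finset.mul_sum]
    rw [e1]; ring
  rw [e]
  linarith
end aux

/-- There is a universal constant `C > 0` such that for every finite
connected graph `G`, every vertex `x` and every `t ≥ 1`:
`Var_x(ℒ_t^{(X,Y)}) ≤ C E_x[ℒ_t^{(X,Y)}] max_{u ∈ V} E_u[𝓘_t]`. -/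
theorem variance_intersections_window_bound : ∃ C : ℝ, 0 < C ∧
    ∀ (V : Type) [Fintype V] [Nontrivial V] (G : SimpleGraph V), G.Connected →
      ∀ (x : V) (t : ℕ), 1 ≤ t →
        ELsq G x t - (EL G x t) ^ 2 ≤ C * EL G x t * ⨆ u : V, EI G u t := by
  refine ⟨4, by norm_num, ?_⟩
  intro V _ _ G hG x t _
  have hd : ∀ y, 0 < G.degree y := fun y => hG.preconnected.degree_pos_of_nontrivial y
  have := second_moment G hd x t
  nlinarith [sq_nonneg (EL G x t)]
end

section
/- There is a universal constant C > 0 such that for every finite connected graph G=(V,E), every vertex x and every t ≥ 1, if X,Y,Z are three independent lazy random walks started at x, then Cov_x(ℒ_t^{(X,Y)}, ℒ_t^{(X,Z)}) ≤ C·(E_x[ℒ_t^{(X,Y)}])^{3/2}·sqrt(max_{u∈V} E_u[𝓘_t]), where ℒ_t^{(X,Y)} (respectively ℒ_t^{(X,Z)}) is the weighted number of intersections of X and Y (respectively X and Z) between times t and 2t−1, and 𝓘_t is the weighted number of intersections of two independent lazy random walks up to time t−1. -/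
open Finset
open scoped Classical BigOperators

section Aux
variable {V : Type} [Fintype V] [Nonempty V]

theorem aux_traj_snoc_lt {T : ℕ} (p : Fin T → V) (w : V) {i : ℕ} (h : i < T) :
    traj (Fin.snoc (α := fun _ => V) p w : Fin (T+1) → V) i = traj p i := by
  have h' : i < T + 1 := by omega
  simp only [traj, h, h', dif_pos]
  simp [Fin.snoc, h]

theorem aux_traj_snoc_last {T : ℕ} (p : Fin T → V) (w : V) :
    traj (Fin.snoc (α := fun _ => V) p w : Fin (T+1) → V) T = w := by
  simp [traj, Fin.snoc]

theorem aux_pw_snoc (P : Matrix V V ℝ) (x : V) {T : ℕ} (p : Fin (T+1) → V) (w : V) :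
    pathWeight P x (T+2) (Fin.snoc (α := fun _ => V) p w) =
      pathWeight P x (T+1) p * P (traj p T) w := by
  unfold pathWeight
  rw [aux_traj_snoc_lt p w (Nat.succ_pos T)]
  have e1 : T + 2 - 1 = T + 1 := by omega
  have e2 : T + 1 - 1 = T := by omega
  rw [e1, e2, Finset.prod_range_succ, aux_traj_snoc_lt p w (Nat.lt_succ_self T),
    aux_traj_snoc_last, mul_assoc]
  congr 2
  apply Finset.prod_congr rfl
  intro i hi
  have := Finset.mem_range.1 hi
  rw [aux_traj_snoc_lt p w (by omega), aux_traj_snoc_lt p w (by omega)]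

theorem aux_step_s18 (P : Matrix V V ℝ) (x : V) {T : ℕ} (H : (Fin (T+2) → V) → ℝ) :
    ∑ p, pathWeight P x (T+2) p * H p =
      ∑ p : Fin (T+1) → V, pathWeight P x (T+1) p *
        ∑ w, P (traj p T) w * H (Fin.snoc (α := fun _ => V) p w) := by
  rw [← (Fin.snocEquiv (fun _ : Fin (T+2) => V)).sum_comp, Fintype.sum_prod_type, Finset.sum_comm]
  apply Finset.sum_congr rfl
  intro p _
  rw [Finset.mul_sum]
  apply Finset.sum_congr rfl
  intro w _
  have := aux_pw_snoc P x p w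
  simp only [Fin.snocEquiv, Equiv.coe_fn_mk]
  rw [this, mul_assoc]

theorem aux_one_s18 (P : Matrix V V ℝ) (x : V) (f : V → ℝ) :
    ∑ p, pathWeight P x 1 p * f (traj p 0) = f x := by
  rw [← (Equiv.funUnique (Fin 1) V).symm.sum_comp]
  simp [pathWeight, traj]

theorem aux_A (P : Matrix V V ℝ) (hP : ∀ u, ∑ v, P u v = 1) (x : V) :
    ∀ (T i : ℕ) (_ : i < T + 1) (f : V → ℝ),
    ∑ p, pathWeight P x (T+1) p * f (traj p i) = ((P^i).mulVec f) x := by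
  intro T
  induction T with
  | zero =>
    intro i hi f
    obtain rfl : i = 0 := by omega
    rw [aux_one_s18]; simp
  | succ T ih =>
    intro i hi f
    rw [aux_step_s18]
    by_cases h : i < T + 1
    · rw [← ih i h f]
      apply Finset.sum_congr rfl
      intro p _
      simp_rw [aux_traj_snoc_lt p _ h]
      rw [← Finset.sum_mul, hP, one_mul]
    · obtain rfl : i = T + 1 := by omega
      simp_rw [aux_traj_snoc_last]
      rw [pow_succ, ← Matrix.mulVec_mulVec, ← ih T (by omega)]
      rfl

theorem aux_B (P : Matrix V V ℝ) (hP : ∀ u, ∑ v, P u v = 1) (x : V) :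
    ∀ (T i j : ℕ) (_ : i ≤ j) (_ : j < T + 1) (f g : V → ℝ),
    ∑ p, pathWeight P x (T+1) p * (f (traj p i) * g (traj p j)) =
      ((P^i).mulVec (f * (P^(j-i)).mulVec g)) x := by
  intro T
  induction T with
  | zero =>
    intro i j hij hj f g
    obtain rfl : j = 0 := by omega
    obtain rfl : i = 0 := by omega
    rw [aux_one_s18 P x (fun v => f v * g v)]; simp
  | succ T ih =>
    intro i j hij hj f g
    by_cases h : j < T + 1
    · rw [aux_step_s18, ← ih i j hij h f g]
      apply Finset.sum_congr rfl
      intro p _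
      simp_rw [aux_traj_snoc_lt p _ h, aux_traj_snoc_lt p _ (lt_of_le_of_lt hij h)]
      rw [← Finset.sum_mul, hP, one_mul]
    · obtain rfl : j = T + 1 := by omega
      by_cases h2 : i = T + 1
      · subst h2
        rw [aux_A P hP x (T+1) (T+1) (by omega) (fun v => f v * g v)]
        simp; rfl
      · have hi : i < T + 1 := by omega
        rw [aux_step_s18]
        have e : T + 1 - i = (T - i) + 1 := by omega
        rw [e, pow_succ, ← Matrix.mulVec_mulVec, ← ih i T (by omega) (by omega)]
        apply Finset.sum_congr rfl
        intro p _
        simp_rw [aux_traj_snoc_lt p _ hi, aux_traj_snoc_last]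
        congr 1
        simp only [Matrix.mulVec, dotProduct, Finset.mul_sum]
        apply Finset.sum_congr rfl
        intro w _
        ring

/-- window occupation -/
noncomputable def auxK (P : Matrix V V ℝ) (x : V) (a b : ℕ) (v : V) : ℝ :=
  ∑ j ∈ Finset.Ico a b, (P^j) x v

theorem aux_inner (G : SimpleGraph V) (hP : ∀ u, ∑ v, lazyP G u v = 1) (x : V) (a b T : ℕ)
    (hb : b ≤ T) (p : Fin T → V) :
    ∑ q, pathWeight (lazyP G) x T q * wInterIco G a b p q =
      ∑ i ∈ Finset.Ico a b, auxK (lazyP G) x a b (traj p i) / (G.degree (traj p i) : ℝ) := by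
  unfold wInterIco auxK
  simp_rw [Finset.mul_sum]
  rw [Finset.sum_comm]
  apply Finset.sum_congr rfl
  intro i _
  rw [Finset.sum_comm, Finset.sum_div]
  apply Finset.sum_congr rfl
  intro j hj
  have hj' := Finset.mem_Ico.1 hj
  obtain ⟨S, rfl⟩ : ∃ S, T = S + 1 := ⟨T - 1, by omega⟩
  rw [aux_A (lazyP G) hP x S j (by omega)
    (fun w => if traj p i = w then 1 / (G.degree (traj p i) : ℝ) else 0)]
  simp [Matrix.mulVec, dotProduct, div_eq_mul_inv]

theorem aux_E2_s18 (G : SimpleGraph V) (hP : ∀ u, ∑ v, lazyP G u v = 1) (x : V) (a b T : ℕ)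
    (hb : b ≤ T) :
    E2 (lazyP G) x x T (fun p q => wInterIco G a b p q) =
      ∑ v, (auxK (lazyP G) x a b v)^2 / (G.degree v : ℝ) := by
  unfold E2
  simp_rw [mul_assoc, ← Finset.mul_sum, aux_inner G hP x a b T hb]
  simp_rw [Finset.mul_sum]
  rw [Finset.sum_comm]
  have : ∀ v, (auxK (lazyP G) x a b v)^2 / (G.degree v : ℝ) =
      ∑ i ∈ Finset.Ico a b, ((lazyP G)^i) x v * (auxK (lazyP G) x a b v / (G.degree v : ℝ)) := by
    intro v
    rw [← Finset.sum_mul]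
    change _ = auxK (lazyP G) x a b v * _
    ring
  simp_rw [this]
  rw [Finset.sum_comm (s := Finset.univ) (t := Finset.Ico a b)]
  apply Finset.sum_congr rfl
  intro i hi
  have hi' := Finset.mem_Ico.1 hi
  obtain ⟨S, rfl⟩ : ∃ S, T = S + 1 := ⟨T - 1, by omega⟩
  rw [aux_A (lazyP G) hP x S i (by omega)
    (fun w => auxK (lazyP G) x a b w / (G.degree w : ℝ))]
  rfl

theorem aux_E3 (G : SimpleGraph V) (hP : ∀ u, ∑ v, lazyP G u v = 1) (x : V) (a b T : ℕ)
    (hb : b ≤ T) (h : V → ℝ) (hh : h = fun v => auxK (lazyP G) x a b v / (G.degree v : ℝ)) :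
    E3 (lazyP G) x T (fun p q r => wInterIco G a b p q * wInterIco G a b p r) =
      ∑ p, pathWeight (lazyP G) x T p * (∑ i ∈ Finset.Ico a b, h (traj p i))^2 := by
  unfold E3
  apply Finset.sum_congr rfl
  intro p _
  have := aux_inner G hP x a b T hb p
  rw [hh]
  simp only []
  rw [← this, sq, Finset.sum_mul_sum, Finset.mul_sum]
  apply Finset.sum_congr rfl
  intro q _
  rw [Finset.mul_sum]
  apply Finset.sum_congr rfl
  intro r _
  ring

theorem aux_sq_sum (s : Finset ℕ) (u : ℕ → ℝ) (hu : ∀ i, 0 ≤ u i) :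
    (∑ i ∈ s, u i)^2 ≤ 2 * ∑ i ∈ s, ∑ j ∈ s.filter (fun j => i ≤ j), u i * u j := by
  rw [sq, Finset.sum_mul_sum, two_mul]
  simp_rw [Finset.sum_filter]
  nth_rewrite 3 [Finset.sum_comm]
  rw [← Finset.sum_add_distrib]
  apply Finset.sum_le_sum
  intro i _
  rw [← Finset.sum_add_distrib]
  apply Finset.sum_le_sum
  intro j _
  have := mul_nonneg (hu i) (hu j)
  rcases le_total i j with h | h
  · rw [if_pos h]; split_ifs <;> linarith
  · rw [if_pos h]; split_ifs <;> linarith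

theorem aux_lazy_nonneg (G : SimpleGraph V) (u v : V) : 0 ≤ lazyP G u v := by
  unfold lazyP; split_ifs <;> positivity

theorem aux_pow_nonneg_s18 (G : SimpleGraph V) (i : ℕ) : ∀ u v : V, 0 ≤ (lazyP G ^ i) u v := by
  induction i with
  | zero => intro u v; simp only [pow_zero, Matrix.one_apply]; split_ifs <;> norm_num
  | succ n ih =>
    intro u v
    rw [pow_succ, Matrix.mul_apply]
    exact Finset.sum_nonneg fun w _ => mul_nonneg (ih _ _) (aux_lazy_nonneg _ _ _)

theorem aux_stoch (G : SimpleGraph V) (hd : ∀ u, 0 < G.degree u) (u : V) :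
    ∑ v, lazyP G u v = 1 := by
  have h : ∀ v, lazyP G u v = (if u = v then 1/2 else 0) +
      (if G.Adj u v then 1 / (2 * (G.degree u : ℝ)) else 0) := by
    intro v
    unfold lazyP
    by_cases e : u = v
    · subst e; simp
    · simp [e]
  simp_rw [h]
  rw [Finset.sum_add_distrib, Finset.sum_ite_eq, ← Finset.sum_filter, Finset.sum_const]
  have : (Finset.univ.filter (fun v => G.Adj u v)).card = G.degree u := by
    rw [← SimpleGraph.card_neighborFinset_eq_degree, SimpleGraph.neighborFinset_eq_filter]
  rw [this]
  have := hd u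
  have : (G.degree u : ℝ) ≠ 0 := by positivity
  simp
  field_simp
  norm_num

theorem aux_K_nonneg (G : SimpleGraph V) (x : V) (a b : ℕ) (v : V) :
    0 ≤ auxK (lazyP G) x a b v :=
  Finset.sum_nonneg fun _ _ => aux_pow_nonneg_s18 _ _ _ _

theorem aux_pw_nonneg (G : SimpleGraph V) (x : V) (T : ℕ) (p : Fin T → V) :
    0 ≤ pathWeight (lazyP G) x T p := by
  unfold pathWeight
  refine mul_nonneg (by split_ifs <;> norm_num) (Finset.prod_nonneg fun _ _ => aux_lazy_nonneg _ _ _)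

theorem aux_main (G : SimpleGraph V) (hd : ∀ u, 0 < G.degree u) (x : V) (t : ℕ) :
    ELprod G x t ≤ 2 * (EL G x t) * (Real.sqrt (EL G x t) * Real.sqrt (⨆ u : V, EI G u t)) := by
  have hP := aux_stoch G hd
  have hEL : EL G x t = ∑ v, (auxK (lazyP G) x t (2*t) v)^2 / (G.degree v : ℝ) :=
    aux_E2_s18 G hP x t (2*t) (2*t) le_rfl
  have hEI : ∀ u, EI G u t = ∑ v, (auxK (lazyP G) u 0 t v)^2 / (G.degree v : ℝ) := fun u =>
    aux_E2_s18 G hP u 0 t t le_rfl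
  set M := Real.sqrt (EL G x t) * Real.sqrt (⨆ u : V, EI G u t) with hM
  obtain ⟨h, hh⟩ : ∃ h : V → ℝ, h = fun v => auxK (lazyP G) x t (2*t) v / (G.degree v : ℝ) :=
    ⟨_, rfl⟩
  have hh0 : ∀ v, 0 ≤ h v := fun v => by
    rw [hh]; exact div_nonneg (aux_K_nonneg _ _ _ _ _) (by positivity)
  have hmax : ∀ v, ∑ w, auxK (lazyP G) v 0 t w * h w ≤ M := by
    intro v
    have hle : EI G v t ≤ ⨆ u : V, EI G u t := le_ciSup (f := fun u => EI G u t)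
      (Set.finite_range _).bddAbove v
    have h1 : (∑ w, auxK (lazyP G) v 0 t w * h w)^2 ≤ EI G v t * EL G x t := by
      rw [hEI, hEL]
      apply Finset.sum_sq_le_sum_mul_sum_of_sq_eq_mul
      · intro i _; positivity
      · intro i _; positivity
      · intro i _
        rw [hh]
        have := hd i
        field_simp
    have hel0 : 0 ≤ EL G x t := by
      rw [hEL]; exact Finset.sum_nonneg fun _ _ => by positivity
    rw [hM, ← Real.sqrt_mul hel0]
    apply Real.le_sqrt_of_sq_le
    nlinarith
  have hE : ELprod G x t = _ := aux_E3 G hP x t (2*t) (2*t) le_rfl h hh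
  rw [hE]
  calc _ ≤ ∑ p, pathWeight (lazyP G) x (2*t) p * (2 * ∑ i ∈ Finset.Ico t (2*t),
        ∑ j ∈ (Finset.Ico t (2*t)).filter (fun j => i ≤ j), h (traj p i) * h (traj p j)) := by
        apply Finset.sum_le_sum
        intro p _
        exact mul_le_mul_of_nonneg_left (aux_sq_sum _ (fun i => h (traj p i)) fun i => hh0 _)
          (aux_pw_nonneg _ _ _ _)
    _ = 2 * ∑ i ∈ Finset.Ico t (2*t), ∑ j ∈ (Finset.Ico t (2*t)).filter (fun j => i ≤ j),
        ∑ p, pathWeight (lazyP G) x (2*t) p * (h (traj p i) * h (traj p j)) := by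
        simp_rw [mul_left_comm _ (2:ℝ), ← Finset.mul_sum]
        congr 1
        simp_rw [Finset.mul_sum]
        rw [Finset.sum_comm]
        apply Finset.sum_congr rfl
        intro i _
        rw [Finset.sum_comm]
    _ = 2 * ∑ i ∈ Finset.Ico t (2*t), ∑ j ∈ (Finset.Ico t (2*t)).filter (fun j => i ≤ j),
        ∑ v, (lazyP G ^ i) x v * (h v * ∑ w, (lazyP G ^ (j-i)) v w * h w) := by
        congr 1
        apply Finset.sum_congr rfl
        intro i _
        apply Finset.sum_congr rfl
        intro j hj
        simp only [Finset.mem_filter, Finset.mem_Ico] at hj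
        obtain ⟨S, hS⟩ : ∃ S, 2 * t = S + 1 := ⟨2 * t - 1, by omega⟩
        rw [hS, aux_B (lazyP G) hP x S i j hj.2 (by omega) h h]
        rfl
    _ ≤ 2 * ∑ i ∈ Finset.Ico t (2*t), ∑ v, (lazyP G ^ i) x v * (h v * M) := by
        refine mul_le_mul_of_nonneg_left ?_ (by norm_num)
        apply Finset.sum_le_sum
        intro i hi
        rw [Finset.sum_comm]
        apply Finset.sum_le_sum
        intro v _
        rw [← Finset.mul_sum, ← Finset.mul_sum]
        refine mul_le_mul_of_nonneg_left ?_ (aux_pow_nonneg_s18 _ _ _ _)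
        refine mul_le_mul_of_nonneg_left ?_ (hh0 v)
        refine le_trans ?_ (hmax v)
        rw [Finset.sum_comm]
        apply Finset.sum_le_sum
        intro w _
        rw [← Finset.sum_mul]
        refine mul_le_mul_of_nonneg_right ?_ (hh0 w)
        unfold auxK
        rw [← Finset.sum_image (f := fun k => (lazyP G ^ k) v w) (g := fun j => j - i)]
        · apply Finset.sum_le_sum_of_subset_of_nonneg
          · intro k hk
            simp only [Finset.mem_image, Finset.mem_filter, Finset.mem_Ico] at hk hi ⊢
            omega
          · intro k _ _; exact aux_pow_nonneg_s18 _ _ _ _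
        · intro a ha b hb hab
          simp only [Finset.coe_filter, Set.mem_setOf_eq] at ha hb hab
          omega
    _ = 2 * (EL G x t) * M := by
        rw [Finset.sum_comm, hEL, mul_assoc, Finset.sum_mul]
        congr 1
        apply Finset.sum_congr rfl
        intro v _
        rw [← Finset.sum_mul]
        change auxK (lazyP G) x t (2*t) v * _ = _
        rw [hh]
        ring

end Aux

/-- There is a universal constant `C > 0` such that for every finite
connected graph `G`, every vertex `x` and every `t ≥ 1`, for three independent lazy random
walks `X, Y, Z` started at `x`:
`Cov_x(ℒ_t^{(X,Y)}, ℒ_t^{(X,Z)}) ≤ C (E_x[ℒ_t^{(X,Y)}])^{3/2} √(max_{u ∈ V} E_u[𝓘_t])`. -/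
theorem covariance_intersections_window_bound : ∃ C : ℝ, 0 < C ∧
    ∀ (V : Type) [Fintype V] [Nontrivial V] (G : SimpleGraph V), G.Connected →
      ∀ (x : V) (t : ℕ), 1 ≤ t →
        ELprod G x t - EL G x t * EL G x t ≤
          C * (EL G x t) ^ ((3 : ℝ) / 2) * Real.sqrt (⨆ u : V, EI G u t) := by
  
  refine ⟨2, by norm_num, ?_⟩
  intro V _ _ G hG x t _
  have hd : ∀ u, 0 < G.degree u := fun u => hG.preconnected.degree_pos_of_nontrivial u
  have h := aux_main G hd x t
  have h0 : 0 ≤ EL G x t := by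
    unfold EL
    rw [aux_E2_s18 G (aux_stoch G hd) x t (2*t) (2*t) le_rfl]
    exact Finset.sum_nonneg fun _ _ => by positivity
  have e : (EL G x t) ^ ((3 : ℝ) / 2) = EL G x t * Real.sqrt (EL G x t) := by
    rw [Real.sqrt_eq_rpow]
    have : ((3:ℝ)/2) = 1 + 1/2 := by norm_num
    rw [this, Real.rpow_add' h0 (by norm_num), Real.rpow_one]
  rw [e]
  nlinarith [mul_self_nonneg (EL G x t)]
end
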